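/- arXiv:1111.6927 — 7 statements merged into one kernel-verified Lean document; each statement's English description precedes it below -/
import Mathlib

section
/- Assume case (BS3). Then: (i) (Γ, Λ) is locally finitely exhaustible: for each t ∈ Γ there is a finite set F ⊆ tΛ ∩ Λ such that every element μ of tΛ ∩ Λ satisfies μΛ ∩ αΛ ≠ ∅ for some α ∈ F. (ii) (Γ, Λ) is finitely aligned (i.e., for each t ∈ Γ there is a finite set F ⊆ tΛ ∩ Λ with tΛ ∩ Λ = ⋃_{α∈F} αΛ) if and only if c = 1. (iii) If c = 1 then ΛΛ^{-1} = Λ ∪ Λ^{-1}, so (Γ, Λ) is totally ordered and hence quasi-lattice ordered. -/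
inductive BSGen : Type
  | a : BSGen
  | b : BSGen

/-- The relations for the Baumslag–Solitar presentation `⟨a, b | a bᶜ = bᵉ a⟩`.
For cases (BS1), (BS2) take `e = d`; for case (BS3) take `e = -d`. -/
def BSRel (c e : ℤ) : Set (FreeGroup BSGen) :=
  {FreeGroup.of BSGen.a * FreeGroup.of BSGen.b ^ c *
    (FreeGroup.of BSGen.b ^ e * FreeGroup.of BSGen.a)⁻¹}

/-- The Baumslag–Solitar group `Γ = ⟨a, b | a bᶜ = bᵉ a⟩`. -/
abbrev BSGroup (c e : ℤ) := PresentedGroup (BSRel c e)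

/-- The generator `a` of `Γ`. -/
def bsa (c e : ℤ) : BSGroup c e := PresentedGroup.of BSGen.a

/-- The generator `b` of `Γ`. -/
def bsb (c e : ℤ) : BSGroup c e := PresentedGroup.of BSGen.b

/-- `Λ`, the submonoid of `Γ` generated by `a` and `b`. -/
def bsΛ (c e : ℤ) : Submonoid (BSGroup c e) :=
  Submonoid.closure {bsa c e, bsb c e}

namespace BaumslagSolitar

open Multiplicative

section Basic

variable {c d : ℤ}

theorem bsa_semiconj : SemiconjBy (bsa c (-d)) (bsb c (-d) ^ c) (bsb c (-d) ^ (-d)) := by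
  have h : PresentedGroup.mk (BSRel c (-d)) (FreeGroup.of BSGen.a * FreeGroup.of BSGen.b ^ c *
      (FreeGroup.of BSGen.b ^ (-d) * FreeGroup.of BSGen.a)⁻¹) = 1 :=
    PresentedGroup.one_of_mem (Set.mem_singleton _)
  rw [map_mul, map_inv, mul_inv_eq_one, map_mul, map_mul, map_zpow, map_zpow] at h
  exact h

theorem shift (i j k : ℤ) :
    bsb c (-d) ^ (i + d * k) * bsa c (-d) * bsb c (-d) ^ (j + c * k) =
      bsb c (-d) ^ i * bsa c (-d) * bsb c (-d) ^ j := by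
  have h := (bsa_semiconj (c := c) (d := d)).zpow_right k
  rw [← zpow_mul, ← zpow_mul] at h
  rw [add_comm j, zpow_add _ (c * k), mul_assoc, ← mul_assoc (bsa c (-d)), h.eq, zpow_add]
  simp [mul_assoc]

/-- The homomorphism out of `⟨a, b | a bᶜ = b⁻ᵈ a⟩` sending `a` to `x` and `b` to `y`. -/
def lift {G : Type*} [Group G] (x y : G) (h : x * y ^ c = y ^ (-d) * x) :
    BSGroup c (-d) →* G :=
  PresentedGroup.toGroup (f := fun g => BSGen.casesOn g x y) (by
    rintro r rfl
    simp only [map_mul, map_inv, map_zpow, FreeGroup.lift_apply_of]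
    exact mul_inv_eq_one.2 h)

@[simp] theorem lift_bsa {G : Type*} [Group G] (x y : G) (h : x * y ^ c = y ^ (-d) * x) :
    lift x y h (bsa c (-d)) = x := PresentedGroup.toGroup.of _

@[simp] theorem lift_bsb {G : Type*} [Group G] (x y : G) (h : x * y ^ c = y ^ (-d) * x) :
    lift x y h (bsb c (-d)) = y := PresentedGroup.toGroup.of _

/-- The submonoid generated by `a` and `b^{±1}`. -/
def posCone (c d : ℤ) : Submonoid (BSGroup c (-d)) :=
  Submonoid.closure {bsa c (-d), bsb c (-d), (bsb c (-d))⁻¹}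

theorem bsa_mem : bsa c (-d) ∈ posCone c d := Submonoid.subset_closure (by simp)

theorem zpow_mem (i : ℤ) : bsb c (-d) ^ i ∈ posCone c d := by
  obtain ⟨n, rfl | rfl⟩ := i.eq_nat_or_neg
  · rw [zpow_natCast]
    exact pow_mem (Submonoid.subset_closure (by simp)) n
  · rw [zpow_neg, zpow_natCast, ← inv_pow]
    exact pow_mem (Submonoid.subset_closure (by simp)) n

theorem posCone_induction_right {motive : ∀ p : BSGroup c (-d), p ∈ posCone c d → Prop}
    (one : motive 1 (one_mem _))
    (mul_a : ∀ p hp, motive p hp → motive (p * bsa c (-d)) (mul_mem hp bsa_mem))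
    (mul_b : ∀ p hp (i : ℤ), motive p hp →
      motive (p * bsb c (-d) ^ i) (mul_mem hp (zpow_mem i)))
    {p : BSGroup c (-d)} (hp : p ∈ posCone c d) : motive p hp := by
  induction hp using Submonoid.closure_induction_right with
  | one => exact one
  | mul_right x hx y hy ih =>
    rcases hy with rfl | rfl | rfl
    · exact mul_a x hx ih
    · simpa using mul_b x hx 1 ih
    · simpa using mul_b x hx (-1) ih

theorem posCone_induction_left {motive : ∀ p : BSGroup c (-d), p ∈ posCone c d → Prop}
    (one : motive 1 (one_mem _))
    (a_mul : ∀ p hp, motive p hp → motive (bsa c (-d) * p) (mul_mem bsa_mem hp))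
    (b_mul : ∀ p hp (i : ℤ), motive p hp →
      motive (bsb c (-d) ^ i * p) (mul_mem (zpow_mem i) hp))
    {p : BSGroup c (-d)} (hp : p ∈ posCone c d) : motive p hp := by
  induction hp using Submonoid.closure_induction_left with
  | one => exact one
  | mul_left y hy x hx ih =>
    rcases hy with rfl | rfl | rfl
    · exact a_mul x hx ih
    · simpa using b_mul x hx 1 ih
    · simpa using b_mul x hx (-1) ih

theorem exists_right_factor {p : BSGroup c (-d)} (hp : p ∈ posCone c d) :
    (∃ i : ℤ, p = bsb c (-d) ^ i) ∨
      ∃ p' ∈ posCone c d, ∃ i : ℤ, p = p' * (bsa c (-d) * bsb c (-d) ^ i) := by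
  induction hp using posCone_induction_right with
  | one => exact Or.inl ⟨0, by simp⟩
  | mul_a p hp _ => exact Or.inr ⟨p, hp, 0, by simp⟩
  | mul_b p hp i ih =>
    rcases ih with ⟨j, rfl⟩ | ⟨p', hp', j, rfl⟩
    · exact Or.inl ⟨j + i, (zpow_add _ _ _).symm⟩
    · exact Or.inr ⟨p', hp', j + i, by simp [zpow_add, mul_assoc]⟩

theorem exists_left_factor {p : BSGroup c (-d)} (hp : p ∈ posCone c d) :
    (∃ i : ℤ, p = bsb c (-d) ^ i) ∨
      ∃ p' ∈ posCone c d, ∃ i : ℤ, p = bsb c (-d) ^ i * bsa c (-d) * p' := by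
  induction hp using posCone_induction_left with
  | one => exact Or.inl ⟨0, by simp⟩
  | a_mul p hp _ => exact Or.inr ⟨p, hp, 0, by simp⟩
  | b_mul p hp i ih =>
    rcases ih with ⟨j, rfl⟩ | ⟨p', hp', j, rfl⟩
    · exact Or.inl ⟨i + j, (zpow_add _ _ _).symm⟩
    · exact Or.inr ⟨p', hp', i + j, by simp [zpow_add, mul_assoc]⟩

/-- The exponent sum of `a`. -/
def degree (c d : ℤ) (g : BSGroup c (-d)) : ℤ :=
  toAdd (lift (c := c) (d := d) (ofAdd (1 : ℤ)) 1 (by simp) g)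

@[simp] theorem degree_one : degree c d 1 = 0 := by simp [degree]

@[simp] theorem degree_mul (g h : BSGroup c (-d)) :
    degree c d (g * h) = degree c d g + degree c d h := by simp [degree]

@[simp] theorem degree_inv (g : BSGroup c (-d)) : degree c d g⁻¹ = -degree c d g := by
  simp [degree]

@[simp] theorem degree_bsa : degree c d (bsa c (-d)) = 1 := by simp [degree]

@[simp] theorem degree_bsb : degree c d (bsb c (-d)) = 0 := by simp [degree]

@[simp] theorem degree_zpow (i : ℤ) : degree c d (bsb c (-d) ^ i) = 0 := by simp [degree]

theorem degree_nonneg {p : BSGroup c (-d)} (hp : p ∈ posCone c d) : 0 ≤ degree c d p := by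
  induction hp using posCone_induction_right with
  | one => simp
  | mul_a p hp ih => simpa using ih.trans (Int.le_add_one le_rfl)
  | mul_b p hp i ih => simpa using ih

theorem eq_zpow_of_degree_le {p : BSGroup c (-d)} (hp : p ∈ posCone c d)
    (h : degree c d p ≤ 0) : ∃ i : ℤ, p = bsb c (-d) ^ i := by
  rcases exists_right_factor hp with h' | ⟨p', hp', i, rfl⟩
  · exact h'
  · have := degree_nonneg hp'
    simp only [degree_mul, degree_bsa, degree_zpow] at h
    omega

theorem bsΛ_le : bsΛ c (-d) ≤ posCone c d :=
  Submonoid.closure_mono (by rintro x (rfl | rfl) <;> simp)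

theorem bsa_mem_bsΛ : bsa c (-d) ∈ bsΛ c (-d) := Submonoid.subset_closure (by simp)

theorem zpow_mem_bsΛ {i : ℤ} (hi : 0 ≤ i) : bsb c (-d) ^ i ∈ bsΛ c (-d) := by
  lift i to ℕ using hi
  rw [zpow_natCast]
  exact pow_mem (Submonoid.subset_closure (by simp)) i

theorem zpow_mul_bsa_mul_zpow_mem (hc : 0 < c) (hd : 0 < d) (i j : ℤ) :
    bsb c (-d) ^ i * bsa c (-d) * bsb c (-d) ^ j ∈ bsΛ c (-d) := by
  rw [← shift i j (|i| + |j|)]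
  have hi := neg_abs_le i
  have hj := neg_abs_le j
  have hi' := abs_nonneg i
  have hj' := abs_nonneg j
  exact mul_mem (mul_mem (zpow_mem_bsΛ (by nlinarith)) bsa_mem_bsΛ) (zpow_mem_bsΛ (by nlinarith))

theorem mul_bsa_mul_mem (hc : 0 < c) (hd : 0 < d) {p q : BSGroup c (-d)}
    (hp : p ∈ posCone c d) (hq : q ∈ posCone c d) : p * bsa c (-d) * q ∈ bsΛ c (-d) := by
  have key : ∀ {p}, p ∈ posCone c d → ∀ i j : ℤ,
      p * (bsb c (-d) ^ i * bsa c (-d) * bsb c (-d) ^ j) ∈ bsΛ c (-d) := by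
    intro p hp
    induction hp using posCone_induction_right with
    | one => simpa using zpow_mul_bsa_mul_zpow_mem hc hd
    | mul_a p hp ih =>
      intro i j
      simpa [mul_assoc] using mul_mem (ih 0 0) (zpow_mul_bsa_mul_zpow_mem hc hd i j)
    | mul_b p hp k ih =>
      intro i j
      simpa [zpow_add, mul_assoc] using ih (k + i) j
  rcases exists_right_factor hq with ⟨i, rfl⟩ | ⟨q', hq', i, rfl⟩
  · simpa [mul_assoc] using key hp 0 i
  · simpa [mul_assoc] using key (mul_mem (mul_mem hp bsa_mem) hq') 0 i

theorem zpow_or_mul_bsa_mul {p : BSGroup c (-d)} (hp : p ∈ posCone c d) :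
    (∃ i : ℤ, p = bsb c (-d) ^ i) ∨
      ∃ q ∈ posCone c d, ∃ r ∈ posCone c d, p = q * bsa c (-d) * r := by
  rcases exists_right_factor hp with h | ⟨p', hp', i, rfl⟩
  · exact Or.inl h
  · exact Or.inr ⟨p', hp', _, zpow_mem i, (mul_assoc _ _ _).symm⟩

theorem mem_or_inv_mem_bsΛ (hc : 0 < c) (hd : 0 < d) {p : BSGroup c (-d)}
    (hp : p ∈ posCone c d) : p ∈ bsΛ c (-d) ∨ p⁻¹ ∈ bsΛ c (-d) := by
  rcases zpow_or_mul_bsa_mul hp with ⟨i, rfl⟩ | ⟨q, hq, r, hr, rfl⟩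
  · rw [← zpow_neg]
    exact (le_total 0 i).imp zpow_mem_bsΛ fun h => zpow_mem_bsΛ (neg_nonneg.2 h)
  · exact Or.inl (mul_bsa_mul_mem hc hd hq hr)

theorem exists_mul_zpow_mem (hc : 0 < c) (hd : 0 < d) {p : BSGroup c (-d)}
    (hp : p ∈ posCone c d) : ∃ k : ℤ, ∀ n, k ≤ n → p * bsb c (-d) ^ n ∈ bsΛ c (-d) := by
  rcases zpow_or_mul_bsa_mul hp with ⟨i, rfl⟩ | ⟨q, hq, r, hr, rfl⟩
  · refine ⟨-i, fun n hn => ?_⟩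
    rw [← zpow_add]
    exact zpow_mem_bsΛ (by linarith)
  · refine ⟨0, fun n _ => ?_⟩
    rw [mul_assoc]
    exact mul_bsa_mul_mem hc hd hq (mul_mem hr (zpow_mem n))

end Basic

section Britton

variable {c d : ℤ}

/-- The product `a^{ε₁} b^{n₁} ⋯ a^{εₖ} b^{nₖ}`. -/
def word (c d : ℤ) (L : List (ℤˣ × ℤ)) : BSGroup c (-d) :=
  (L.map fun x => bsa c (-d) ^ (x.1 : ℤ) * bsb c (-d) ^ x.2).prod

/-- No pinch occurs at two consecutive letters of a word. -/
def NoPinch (c d : ℤ) (x y : ℤˣ × ℤ) : Prop :=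
  x.1 = y.1 ∨ (x.1 = 1 ∧ ¬ c ∣ x.2) ∨ (x.1 = -1 ∧ ¬ d ∣ x.2)

@[simp] theorem word_nil : word c d [] = 1 := rfl

@[simp] theorem word_cons (x : ℤˣ × ℤ) (L : List (ℤˣ × ℤ)) :
    word c d (x :: L) = bsa c (-d) ^ (x.1 : ℤ) * bsb c (-d) ^ x.2 * word c d L := by
  simp [word]

@[simp] theorem word_append (L M : List (ℤˣ × ℤ)) :
    word c d (L ++ M) = word c d L * word c d M := by
  simp [word]

theorem exists_word {p : BSGroup c (-d)} (hp : p ∈ posCone c d) :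
    ∃ (i : ℤ) (L : List (ℤˣ × ℤ)), (∀ x ∈ L, x.1 = 1) ∧ p = bsb c (-d) ^ i * word c d L := by
  induction hp using posCone_induction_left with
  | one => exact ⟨0, [], by simp, by simp⟩
  | a_mul p _ ih =>
    obtain ⟨i, L, hL, rfl⟩ := ih
    exact ⟨0, (1, i) :: L, by simpa using hL, by simp [mul_assoc]⟩
  | b_mul p _ k ih =>
    obtain ⟨i, L, hL, rfl⟩ := ih
    exact ⟨k + i, L, hL, by simp [zpow_add, mul_assoc]⟩

theorem exists_word_inv {p : BSGroup c (-d)} (hp : p ∈ posCone c d) :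
    ∃ (i : ℤ) (L : List (ℤˣ × ℤ)), (∀ x ∈ L, x.1 = -1) ∧ p⁻¹ = bsb c (-d) ^ i * word c d L := by
  induction hp using posCone_induction_right with
  | one => exact ⟨0, [], by simp, by simp⟩
  | mul_a p _ ih =>
    obtain ⟨i, L, hL, h⟩ := ih
    exact ⟨0, (-1, i) :: L, by simpa using hL, by simp [mul_assoc, h]⟩
  | mul_b p _ k ih =>
    obtain ⟨i, L, hL, h⟩ := ih
    exact ⟨-k + i, L, hL, by simp [zpow_add, mul_assoc, h]⟩

theorem word_inv_mem {L : List (ℤˣ × ℤ)} (hL : ∀ x ∈ L, x.1 = -1) :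
    (word c d L)⁻¹ ∈ posCone c d := by
  induction L with
  | nil => simp
  | cons x L ih =>
    simp only [List.mem_cons, forall_eq_or_imp] at hL
    rw [word_cons, hL.1, mul_inv_rev, mul_inv_rev, ← zpow_neg, ← zpow_neg]
    simpa using mul_mem (ih hL.2) (mul_mem (zpow_mem (-x.2)) bsa_mem)

theorem conj_word_inv_mem {L : List (ℤˣ × ℤ)} (hL : ∀ x ∈ L, x.1 = -1) :
    bsa c (-d) * (word c d L)⁻¹ * (bsa c (-d))⁻¹ ∈ posCone c d := by
  cases L with
  | nil => simp
  | cons x L =>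
    simp only [List.mem_cons, forall_eq_or_imp] at hL
    rw [word_cons, hL.1, mul_inv_rev, mul_inv_rev, ← zpow_neg, ← zpow_neg]
    simpa [mul_assoc] using mul_mem bsa_mem (mul_mem (word_inv_mem hL.2) (zpow_mem (-x.2)))

theorem zpowGroupHom_injective {n : ℤ} (hn : n ≠ 0) :
    Function.Injective (zpowGroupHom n : Multiplicative ℤ →* Multiplicative ℤ) := by
  intro x y h
  have h' : n * toAdd x = n * toAdd y := by
    simpa using congrArg toAdd h
  exact toAdd.injective (mul_left_cancel₀ hn h')

theorem mem_range_zpowGroupHom {n : ℤ} (x : Multiplicative ℤ) :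
    x ∈ (zpowGroupHom n : Multiplicative ℤ →* Multiplicative ℤ).range ↔ n ∣ toAdd x := by
  constructor
  · rintro ⟨y, rfl⟩
    exact ⟨toAdd y, by simp⟩
  · rintro ⟨k, hk⟩
    exact ⟨ofAdd k, toAdd.injective (by simp [hk])⟩

/-- The isomorphism `cℤ ≃ dℤ` sending `c` to `-d`. -/
noncomputable def assocIso (hc : c ≠ 0) (hd : -d ≠ 0) :
    (zpowGroupHom c : Multiplicative ℤ →* Multiplicative ℤ).range ≃*
      (zpowGroupHom (-d) : Multiplicative ℤ →* Multiplicative ℤ).range :=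
  (MonoidHom.ofInjective (zpowGroupHom_injective hc)).symm.trans
    (MonoidHom.ofInjective (zpowGroupHom_injective hd))

theorem assocIso_ofInjective (hc : c ≠ 0) (hd : -d ≠ 0) (x : Multiplicative ℤ) :
    assocIso hc hd (MonoidHom.ofInjective (zpowGroupHom_injective hc) x) =
      MonoidHom.ofInjective (zpowGroupHom_injective hd) x := by
  rw [assocIso, MulEquiv.trans_apply, MulEquiv.symm_apply_apply]

/-- The comparison map to the HNN extension of `ℤ` along `assocIso`. -/
noncomputable def toHNN (hc : c ≠ 0) (hd : -d ≠ 0) :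
    BSGroup c (-d) →* HNNExtension (Multiplicative ℤ) _ _ (assocIso hc hd) :=
  lift HNNExtension.t (HNNExtension.of (ofAdd 1)) (by
    have h := HNNExtension.t_mul_of (φ := assocIso hc hd)
      (MonoidHom.ofInjective (zpowGroupHom_injective hc) (ofAdd 1))
    rw [assocIso_ofInjective] at h
    simpa only [MonoidHom.ofInjective_apply, zpowGroupHom_apply, map_zpow] using h)

theorem toHNN_zpow (hc : c ≠ 0) (hd : -d ≠ 0) (i : ℤ) :
    toHNN hc hd (bsb c (-d) ^ i) = HNNExtension.of (ofAdd i) := by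
  rw [toHNN, map_zpow, lift_bsb, ← map_zpow, ← ofAdd_zsmul, smul_eq_mul, mul_one]

theorem toHNN_bsa (hc : c ≠ 0) (hd : -d ≠ 0) :
    toHNN hc hd (bsa c (-d)) = HNNExtension.t := by
  rw [toHNN, lift_bsa]

theorem zpow_bsb_injective (hc : c ≠ 0) (hd : d ≠ 0) :
    Function.Injective fun i : ℤ => bsb c (-d) ^ i := by
  intro i j h
  have h' := congrArg (toHNN hc (neg_ne_zero.2 hd)) h
  simp only [toHNN_zpow] at h'
  exact ofAdd.injective (HNNExtension.of_injective _ h')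

open HNNExtension.NormalWord in
/-- A word without pinches, as a reduced word of the HNN extension. -/
def reducedWord {L : List (ℤˣ × ℤ)} (i : ℤ) (hL : L.IsChain (NoPinch c d)) :
    ReducedWord (Multiplicative ℤ) (zpowGroupHom c).range (zpowGroupHom (-d)).range where
  head := ofAdd i
  toList := L.map fun x => (x.1, ofAdd x.2)
  chain := by
    rw [List.isChain_map]
    refine hL.imp ?_
    rintro ⟨u, m⟩ ⟨v, n⟩ (h | ⟨h, h'⟩ | ⟨h, h'⟩) hm
    · exact h
    · obtain rfl : u = 1 := h
      exact absurd ((mem_range_zpowGroupHom _).1 hm) h'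
    · obtain rfl : u = -1 := h
      exact absurd ((neg_dvd).1 ((mem_range_zpowGroupHom _).1 hm)) h'

theorem reducedWord_prod (hc : c ≠ 0) (hd : -d ≠ 0) {L : List (ℤˣ × ℤ)} (i : ℤ)
    (hL : L.IsChain (NoPinch c d)) :
    (reducedWord i hL).prod (assocIso hc hd) = toHNN hc hd (bsb c (-d) ^ i * word c d L) := by
  simp only [HNNExtension.NormalWord.ReducedWord.prod, reducedWord, word, map_mul, toHNN_zpow,
    map_list_prod, List.map_map]
  congr 3
  funext x
  simp [toHNN_zpow, toHNN_bsa, -map_zpow, map_zpow (toHNN hc hd) (bsa c (-d))]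

theorem isChain_noPinch {L : List (ℤˣ × ℤ)} {u : ℤˣ} (hL : ∀ x ∈ L, x.1 = u) :
    L.IsChain (NoPinch c d) :=
  List.Pairwise.isChain (List.pairwise_of_forall_mem_list fun x hx y hy =>
    Or.inl ((hL x hx).trans (hL y hy).symm))

/-- **Britton's lemma**, for elements of the positive cone. -/
theorem fst_eq_one_of_mem (hc : c ≠ 0) (hd : d ≠ 0) {i : ℤ} {L : List (ℤˣ × ℤ)}
    (hL : L.IsChain (NoPinch c d)) (h : bsb c (-d) ^ i * word c d L ∈ posCone c d) :
    ∀ x ∈ L, x.1 = 1 := by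
  obtain ⟨j, M, hM, hLM⟩ := exists_word h
  have hd' := neg_ne_zero.2 hd
  have key := (HNNExtension.ReducedWord.map_fst_eq_and_of_prod_eq (assocIso hc hd')
    (w₁ := reducedWord i hL) (w₂ := reducedWord j (isChain_noPinch hM))
    (by rw [reducedWord_prod, reducedWord_prod, hLM])).1
  simp only [reducedWord, List.map_map] at key
  intro x hx
  have hx' : x.1 ∈ L.map (Prod.fst ∘ fun x : ℤˣ × ℤ => (x.1, ofAdd x.2)) :=
    List.mem_map.2 ⟨x, hx, rfl⟩
  rw [key] at hx'
  obtain ⟨y, hy, hyx⟩ := List.mem_map.1 hx'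
  exact hyx.symm.trans (hM y hy)

end Britton

section Interpolation

variable {c d : ℤ}

theorem pinchless_not_mem (hc : c ≠ 0) (hd : d ≠ 0) {p r : BSGroup c (-d)}
    (hp : p ∈ posCone c d) (hr : r ∈ posCone c d) {M : List (ℤˣ × ℤ)} (hM : ∀ x ∈ M, x.1 = -1)
    {m n : ℤ} (hm : ¬ c ∣ m) (hn : ¬ d ∣ n) :
    p * word c d ((1, m) :: M ++ [(-1, n)]) * (bsa c (-d) * r) ∉ posCone c d := by
  intro h
  obtain ⟨i, L, hL, rfl⟩ := exists_word hp
  obtain ⟨j, N, hN, rfl⟩ := exists_word hr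
  have hchain : (L ++ ((1, m) :: M ++ (-1, n) :: (1, j) :: N)).IsChain (NoPinch c d) := by
    have h₁ : (L ++ [(1, m)]).IsChain (NoPinch c d) := isChain_noPinch (u := 1) (by
      simpa [or_imp, forall_and] using hL)
    have h₂ : ((1, j) :: N).IsChain (NoPinch c d) := isChain_noPinch (u := 1) (by simpa using hN)
    have h₃ : (M ++ [(-1, n)]).IsChain (NoPinch c d) := isChain_noPinch (u := -1) (by
      simpa [or_imp, forall_and] using hM)
    have h₄ : (M ++ (-1, n) :: (1, j) :: N).IsChain (NoPinch c d) := by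
      rw [List.isChain_append_cons_cons]
      exact ⟨h₃, Or.inr (Or.inr ⟨rfl, hn⟩), h₂⟩
    obtain ⟨x, M', hM'⟩ := List.exists_cons_of_ne_nil
      (show M ++ (-1, n) :: (1, j) :: N ≠ [] by simp)
    rw [List.cons_append, hM', List.isChain_append_cons_cons, ← hM']
    exact ⟨h₁, Or.inr (Or.inl ⟨rfl, hm⟩), h₄⟩
  have := fst_eq_one_of_mem hc hd (i := i) hchain (by simpa [mul_assoc] using h) (-1, n) (by simp)
  exact absurd this (by simp)

theorem exists_common_factor (hc : c ≠ 0) (hd : d ≠ 0) {p q r : BSGroup c (-d)}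
    (hp : p ∈ posCone c d) (hq : q ∈ posCone c d) (hr : r ∈ posCone c d)
    (h : p * q⁻¹ * r ∈ posCone c d) :
    (∃ i : ℤ, q = bsb c (-d) ^ i) ∨
    (∃ p' ∈ posCone c d, ∃ q' ∈ posCone c d, ∃ j : ℤ,
      p = p' * (bsa c (-d) * bsb c (-d) ^ j) ∧ q = q' * (bsa c (-d) * bsb c (-d) ^ j)) ∨
    ∃ q' ∈ posCone c d, ∃ r' ∈ posCone c d, ∃ j : ℤ,
      q = bsb c (-d) ^ j * bsa c (-d) * q' ∧ r = bsb c (-d) ^ j * bsa c (-d) * r' := by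
  rcases exists_left_factor hq with hq | ⟨q', hq', k, rfl⟩
  · exact Or.inl hq
  right
  rcases exists_right_factor hp with ⟨i, rfl⟩ | ⟨p', hp', i, rfl⟩
  · refine Or.inr ⟨q', hq', _, mul_mem hq' (mul_mem (zpow_mem (-i)) h), k, rfl, ?_⟩
    rw [zpow_neg]
    group
  rcases exists_left_factor hr with ⟨l, rfl⟩ | ⟨r', hr', l, rfl⟩
  · obtain ⟨i', hi⟩ | ⟨s, hs, j, hj⟩ := exists_right_factor hq
    · refine Or.inr ⟨q', hq', q' * bsb c (-d) ^ (l - i'), mul_mem hq' (zpow_mem _), k, rfl, ?_⟩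
      rw [← mul_assoc, hi, ← zpow_add, add_sub_cancel]
    · refine Or.inl ⟨_, mul_mem (mul_mem h (zpow_mem (-l))) hs, s, hs, j, ?_, hj⟩
      rw [mul_assoc _ s, ← hj, zpow_neg]
      group
  obtain ⟨j, M, hM, hqM⟩ := exists_word_inv hq'
  by_cases hkl : d ∣ l - k
  · obtain ⟨e, he⟩ := hkl
    refine Or.inr ⟨q', hq', _, mul_mem (zpow_mem (-(c * e))) hr', k, rfl, ?_⟩
    have := shift (c := c) (d := d) k (-(c * e)) e
    rw [neg_add_cancel, zpow_zero, mul_one, ← he, add_sub_cancel] at this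
    rw [this, mul_assoc]
  by_cases hij : c ∣ i + j
  · obtain ⟨e, he⟩ := hij
    refine Or.inl ⟨_, mul_mem hp' (zpow_mem (-(d * e))), _,
      mul_mem (zpow_mem k) (conj_word_inv_mem hM), -j, ?_, ?_⟩
    · have := shift (c := c) (d := d) (-(d * e)) (-j) e
      rw [neg_add_cancel, zpow_zero, one_mul, ← he, neg_add_cancel_comm_assoc] at this
      rw [this, mul_assoc, mul_assoc]
    · rw [← inv_inv q', hqM, mul_inv_rev, zpow_neg]
      group
  · refine absurd h ?_
    have := pinchless_not_mem hc hd hp' hr' hM hij hkl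
    rw [sub_eq_neg_add] at this
    simpa [mul_assoc, hqM, zpow_add] using this

theorem interpolation (hc : c ≠ 0) (hd : d ≠ 0) {p q r : BSGroup c (-d)}
    (hp : p ∈ posCone c d) (hq : q ∈ posCone c d) (hr : r ∈ posCone c d)
    (h : p * q⁻¹ * r ∈ posCone c d) :
    ∃ q₁ ∈ posCone c d, ∃ q₂ ∈ posCone c d,
      q = q₁ * q₂ ∧ p * q₂⁻¹ ∈ posCone c d ∧ q₁⁻¹ * r ∈ posCone c d := by
  induction hn : (degree c d q).toNat using Nat.strong_induction_on
    generalizing p q r with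
  | h n ih =>
  rcases exists_common_factor hc hd hp hq hr h with
    ⟨i, rfl⟩ | ⟨p', hp', q', hq', j, rfl, rfl⟩ | ⟨q', hq', r', hr', j, rfl, rfl⟩
  · refine ⟨_, hq, 1, one_mem _, by simp, by simpa using hp, ?_⟩
    rw [← zpow_neg]
    exact mul_mem (zpow_mem _) hr
  · have h0 := degree_nonneg hq'
    obtain ⟨q₁, hq₁, q₂, hq₂, rfl, h₁, h₂⟩ := ih _ (by
      simp only [← hn, degree_mul, degree_bsa, degree_zpow]
      omega) hp' hq' hr (by simpa [mul_assoc] using h) rfl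
    exact ⟨q₁, hq₁, _, mul_mem hq₂ (mul_mem bsa_mem (zpow_mem j)), by simp [mul_assoc],
      by simpa [mul_assoc] using h₁, h₂⟩
  · have h0 := degree_nonneg hq'
    obtain ⟨q₁, hq₁, q₂, hq₂, rfl, h₁, h₂⟩ := ih _ (by
      simp only [← hn, degree_mul, degree_bsa, degree_zpow]
      omega) hp hq' hr' (by simpa [mul_assoc] using h) rfl
    exact ⟨_, mul_mem (mul_mem (zpow_mem j) bsa_mem) hq₁, q₂, hq₂, by simp [mul_assoc],
      h₁, by simpa [mul_assoc] using h₂⟩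

/-- A nonempty intersection `tP ∩ P`, where `P` is the positive cone, is contained in some `yP`
with `y ∈ tP ∩ P`. -/
theorem exists_isLeast (hc : c ≠ 0) (hd : d ≠ 0) {t x : BSGroup c (-d)}
    (hx : x ∈ posCone c d) (htx : t⁻¹ * x ∈ posCone c d) :
    ∃ y ∈ posCone c d, t⁻¹ * y ∈ posCone c d ∧
      ∀ z ∈ posCone c d, t⁻¹ * z ∈ posCone c d → y⁻¹ * z ∈ posCone c d := by
  induction hn : (degree c d (t⁻¹ * x)).toNat using Nat.strong_induction_on
    generalizing x with
  | h n ih =>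
  by_cases hmin : ∀ z ∈ posCone c d, t⁻¹ * z ∈ posCone c d → x⁻¹ * z ∈ posCone c d
  · exact ⟨x, hx, htx, hmin⟩
  push Not at hmin
  obtain ⟨z, hz, htz, hxz⟩ := hmin
  obtain ⟨q₁, hq₁, q₂, hq₂, hq, h₁, h₂⟩ := interpolation hc hd hx htx htz
    (by simpa [mul_assoc] using hz)
  have hq₁' : t⁻¹ * (x * q₂⁻¹) = q₁ := by rw [← mul_assoc, hq, mul_inv_cancel_right]
  refine ih _ ?_ h₁ (hq₁'.symm ▸ hq₁) rfl
  rw [hq₁', ← hn, hq, degree_mul]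
  have h0 := degree_nonneg hq₁
  rcases exists_right_factor hq₂ with ⟨i, rfl⟩ | ⟨s, hs, i, rfl⟩
  · refine absurd ?_ hxz
    have : x⁻¹ * z = bsb c (-d) ^ (-i) * (q₁⁻¹ * (t⁻¹ * z)) := by
      rw [show x = t * (q₁ * bsb c (-d) ^ i) by rw [← hq, mul_inv_cancel_left], zpow_neg]
      group
    rw [this]
    exact mul_mem (zpow_mem _) h₂
  · have h0' := degree_nonneg hs
    simp only [degree_mul, degree_bsa, degree_zpow]
    omega

end Interpolation

section Alignment

variable {c d : ℤ}

theorem nonneg_of_zpow_mem (hc : c ≠ 0) (hd : d ≠ 0) {i : ℤ}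
    (hi : bsb c (-d) ^ i ∈ bsΛ c (-d)) : 0 ≤ i := by
  have key : ∀ x ∈ bsΛ c (-d), (∃ n : ℤ, 0 ≤ n ∧ x = bsb c (-d) ^ n) ∨ 1 ≤ degree c d x := by
    intro x hx
    induction hx using Submonoid.closure_induction_right with
    | one => exact Or.inl ⟨0, le_rfl, by simp⟩
    | mul_right x hx y hy ih =>
      have hx0 : 0 ≤ degree c d x := degree_nonneg (bsΛ_le hx)
      rcases hy with rfl | rfl
      · right
        simpa using hx0
      · rcases ih with ⟨n, hn, rfl⟩ | h
        · exact Or.inl ⟨n + 1, by omega, (zpow_add_one _ _).symm⟩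
        · right
          simpa using h
  rcases key _ hi with ⟨n, hn, h⟩ | h
  · rwa [zpow_bsb_injective hc hd h]
  · simp at h

theorem exhaustible (hc : 0 < c) (hd : 0 < d) (t : BSGroup c (-d)) :
    ∃ F : Finset (BSGroup c (-d)),
      (∀ α ∈ F, (∃ l ∈ bsΛ c (-d), α = t * l) ∧ α ∈ bsΛ c (-d)) ∧
      (∀ μ : BSGroup c (-d), ((∃ l ∈ bsΛ c (-d), μ = t * l) ∧ μ ∈ bsΛ c (-d)) →
        ∃ α ∈ F, ∃ x : BSGroup c (-d),
          (∃ l ∈ bsΛ c (-d), x = μ * l) ∧ (∃ l ∈ bsΛ c (-d), x = α * l)) := by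
  by_cases h : ∃ x ∈ posCone c d, t⁻¹ * x ∈ posCone c d
  · obtain ⟨x, hx, htx⟩ := h
    obtain ⟨y, hy, hty, hmin⟩ := exists_isLeast hc.ne' hd.ne' hx htx
    obtain ⟨k₁, hk₁⟩ := exists_mul_zpow_mem hc hd hy
    obtain ⟨k₂, hk₂⟩ := exists_mul_zpow_mem hc hd hty
    set n := max k₁ k₂
    refine ⟨{y * bsb c (-d) ^ n}, ?_, ?_⟩
    · simp only [Finset.mem_singleton, forall_eq]
      exact ⟨⟨_, hk₂ n (le_max_right _ _), by group⟩, hk₁ n (le_max_left _ _)⟩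
    · rintro _ ⟨⟨l, hl, rfl⟩, hμ⟩
      refine ⟨_, Finset.mem_singleton_self _, t * l * bsa c (-d), ⟨_, bsa_mem_bsΛ, rfl⟩, ?_⟩
      have hyz := hmin (t * l) (bsΛ_le hμ) (by simpa using bsΛ_le hl)
      refine ⟨_, mul_bsa_mul_mem hc hd (mul_mem (zpow_mem (-n)) hyz) (one_mem _), ?_⟩
      rw [zpow_neg]
      group
  · refine ⟨∅, by simp, ?_⟩
    rintro _ ⟨⟨l, hl, rfl⟩, hμ⟩
    exact absurd ⟨_, bsΛ_le hμ, by simpa using bsΛ_le hl⟩ h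

theorem bsa_mul_bsb_mul_inv_notMem (hc : c ≠ 0) (hd : d ≠ 0) (h : ¬ c ∣ 1) (i : ℤ) :
    bsa c (-d) * bsb c (-d) * (bsa c (-d))⁻¹ * bsb c (-d) ^ i ∉ posCone c d := by
  intro hmem
  have hchain : [((1 : ℤˣ), (1 : ℤ)), (-1, i)].IsChain (NoPinch c d) := by
    simp [NoPinch, h]
  have := fst_eq_one_of_mem hc hd (i := 0) hchain (by simpa [mul_assoc] using hmem) (-1, i)
    (by simp)
  exact absurd this (by simp)

theorem eq_one_of_finitelyAligned (hc : 0 < c) (hd : 0 < d)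
    (H : ∀ t : BSGroup c (-d), ∃ F : Finset (BSGroup c (-d)),
      (∀ α ∈ F, (∃ l ∈ bsΛ c (-d), α = t * l) ∧ α ∈ bsΛ c (-d)) ∧
      (∀ x : BSGroup c (-d), ((∃ l ∈ bsΛ c (-d), x = t * l) ∧ x ∈ bsΛ c (-d)) ↔
        ∃ α ∈ F, ∃ l ∈ bsΛ c (-d), x = α * l)) : c = 1 := by
  by_contra hc1
  have hdvd : ¬ c ∣ 1 := fun h => hc1 (Int.eq_one_of_dvd_one hc.le h)
  obtain ⟨F, hF, hFx⟩ := H (bsa c (-d) * bsb c (-d) * (bsa c (-d))⁻¹)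
  have key : ∀ α : BSGroup c (-d), ∃ k : ℤ, α ∈ F → ∀ j : ℤ,
      (∃ l ∈ bsΛ c (-d), bsa c (-d) * bsb c (-d) ^ j = α * l) → k ≤ j := by
    intro α
    by_cases hα : ∃ k : ℤ, α = bsa c (-d) * bsb c (-d) ^ k
    · obtain ⟨k, rfl⟩ := hα
      refine ⟨k, fun _ j => ?_⟩
      rintro ⟨l, hl, h⟩
      rw [mul_assoc, mul_right_inj, ← inv_mul_eq_iff_eq_mul, ← zpow_neg, ← zpow_add] at h
      have := nonneg_of_zpow_mem hc.ne' hd.ne' (h ▸ hl)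
      omega
    · refine ⟨0, fun hαF j => ?_⟩
      rintro ⟨l, hl, h⟩
      obtain ⟨⟨l₀, hl₀, hαl₀⟩, hαΛ⟩ := hF α hαF
      have hdeg := congrArg (degree c d) h
      simp only [degree_mul, degree_bsa, degree_zpow] at hdeg
      rcases le_or_gt (degree c d l) 0 with hl0 | hl0
      · obtain ⟨s, rfl⟩ := eq_zpow_of_degree_le (bsΛ_le hl) hl0
        refine absurd ⟨j - s, ?_⟩ hα
        rw [zpow_sub, ← mul_assoc, h, mul_inv_cancel_right]
      · have hdeg₀ := congrArg (degree c d) hαl₀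
        simp only [degree_mul, degree_bsa, degree_bsb, degree_inv] at hdeg₀
        obtain ⟨i, rfl⟩ := eq_zpow_of_degree_le (bsΛ_le hl₀) (by omega)
        exact absurd (bsΛ_le hαΛ)
          (hαl₀ ▸ bsa_mul_bsb_mul_inv_notMem hc.ne' hd.ne' hdvd i)
  choose k hk using key
  obtain ⟨m, hm⟩ := (F.finite_toSet.image k).bddBelow
  have hmem : ∀ j : ℤ, bsa c (-d) * bsb c (-d) ^ j ∈ bsΛ c (-d) := fun j => by
    simpa using mul_bsa_mul_mem hc hd (one_mem _) (zpow_mem j)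
  obtain ⟨α, hα, hl⟩ := (hFx (bsa c (-d) * bsb c (-d) ^ (m - 1))).1
    ⟨⟨_, hmem (m - 2), by
      rw [show m - 1 = 1 + (m - 2) by ring, zpow_add]
      group⟩, hmem _⟩
  have h₁ := hk α hα _ hl
  have h₂ := hm ⟨α, hα, rfl⟩
  omega

theorem div_mem_or_div_mem {p q : BSGroup 1 (-d)} (hp : p ∈ posCone 1 d)
    (hq : q ∈ posCone 1 d) : p * q⁻¹ ∈ posCone 1 d ∨ q * p⁻¹ ∈ posCone 1 d := by
  induction hq using posCone_induction_right generalizing p with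
  | one => exact Or.inl (by simpa using hp)
  | mul_a q hq ih =>
    rcases exists_right_factor hp with ⟨i, rfl⟩ | ⟨p', hp', i, rfl⟩
    · right
      rw [← zpow_neg]
      exact mul_mem (mul_mem hq bsa_mem) (zpow_mem _)
    · have hi : bsa 1 (-d) * bsb 1 (-d) ^ i = bsb 1 (-d) ^ (-(d * i)) * bsa 1 (-d) := by
        simpa using (shift (c := 1) (d := d) 0 i (-i)).symm
      rw [hi]
      simpa [mul_assoc] using ih (mul_mem hp' (zpow_mem (-(d * i))))
  | mul_b q hq i ih =>
    simpa [mul_assoc] using ih (mul_mem hp (zpow_mem (-i)))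

theorem mul_inv_mem_iff (hd : 0 < d) (g : BSGroup 1 (-d)) :
    (∃ α ∈ bsΛ 1 (-d), ∃ β ∈ bsΛ 1 (-d), g = α * β⁻¹) ↔
      (g ∈ bsΛ 1 (-d) ∨ g⁻¹ ∈ bsΛ 1 (-d)) := by
  constructor
  · rintro ⟨α, hα, β, hβ, rfl⟩
    rcases div_mem_or_div_mem (bsΛ_le hα) (bsΛ_le hβ) with h | h
    · exact mem_or_inv_mem_bsΛ one_pos hd h
    · simpa [or_comm] using mem_or_inv_mem_bsΛ one_pos hd h
  · rintro (h | h)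
    · exact ⟨g, h, 1, one_mem _, by simp⟩
    · exact ⟨1, one_mem _, _, h, by simp⟩

theorem exists_generator (hd : 0 < d) (t : BSGroup 1 (-d))
    (h : ∃ x : BSGroup 1 (-d), (∃ l ∈ bsΛ 1 (-d), x = t * l) ∧ x ∈ bsΛ 1 (-d)) :
    ∃ α ∈ bsΛ 1 (-d), ∀ x : BSGroup 1 (-d),
      ((∃ l ∈ bsΛ 1 (-d), x = t * l) ∧ x ∈ bsΛ 1 (-d)) ↔ ∃ l ∈ bsΛ 1 (-d), x = α * l := by
  obtain ⟨_, ⟨l, hl, rfl⟩, hx⟩ := h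
  rcases (mul_inv_mem_iff hd t).1 ⟨_, hx, l, hl, by simp⟩ with ht | ht
  · refine ⟨t, ht, fun x => ⟨And.left, ?_⟩⟩
    rintro ⟨m, hm, rfl⟩
    exact ⟨⟨m, hm, rfl⟩, mul_mem ht hm⟩
  · refine ⟨1, one_mem _, fun x => ⟨fun hx => ⟨x, hx.2, (one_mul x).symm⟩, ?_⟩⟩
    rintro ⟨m, hm, rfl⟩
    exact ⟨⟨_, mul_mem ht hm, by group⟩, by simpa using hm⟩

theorem finitelyAligned (hd : 0 < d) (t : BSGroup 1 (-d)) :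
    ∃ F : Finset (BSGroup 1 (-d)),
      (∀ α ∈ F, (∃ l ∈ bsΛ 1 (-d), α = t * l) ∧ α ∈ bsΛ 1 (-d)) ∧
      (∀ x : BSGroup 1 (-d), ((∃ l ∈ bsΛ 1 (-d), x = t * l) ∧ x ∈ bsΛ 1 (-d)) ↔
        ∃ α ∈ F, ∃ l ∈ bsΛ 1 (-d), x = α * l) := by
  by_cases h : ∃ x : BSGroup 1 (-d), (∃ l ∈ bsΛ 1 (-d), x = t * l) ∧ x ∈ bsΛ 1 (-d)
  · obtain ⟨α, hα, hx⟩ := exists_generator hd t h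
    refine ⟨{α}, ?_, by simpa using hx⟩
    simp only [Finset.mem_singleton, forall_eq]
    exact (hx α).2 ⟨1, one_mem _, by simp⟩
  · exact ⟨∅, by simp, fun x => ⟨fun hx => absurd ⟨x, hx⟩ h, by simp⟩⟩

end Alignment

end BaumslagSolitar

/-- Case (BS3) (relation `a b^c = b^{-d} a`).
(i) `(Γ, Λ)` is locally finitely exhaustible: for each `t ∈ Γ` there is a finite
`F ⊆ tΛ ∩ Λ` such that every `μ ∈ tΛ ∩ Λ` meets some `α ∈ F` (`μΛ ∩ αΛ ≠ ∅`).
(ii) `(Γ, Λ)` is finitely aligned (each `tΛ ∩ Λ` is a finite union `⋃_{α∈F} αΛ` with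
`F ⊆ tΛ ∩ Λ`) iff `c = 1`.
(iii) If `c = 1` then `ΛΛ⁻¹ = Λ ∪ Λ⁻¹` (so `(Γ,Λ)` is totally ordered), and `(Γ, Λ)` is
quasi-lattice ordered. -/
theorem statement11 (c d : ℤ) (hc : 0 < c) (hd : 0 < d) :
    (∀ t : BSGroup c (-d), ∃ F : Finset (BSGroup c (-d)),
      (∀ α ∈ F, (∃ l ∈ bsΛ c (-d), α = t * l) ∧ α ∈ bsΛ c (-d)) ∧
      (∀ μ : BSGroup c (-d), ((∃ l ∈ bsΛ c (-d), μ = t * l) ∧ μ ∈ bsΛ c (-d)) →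
        ∃ α ∈ F, ∃ x : BSGroup c (-d),
          (∃ l ∈ bsΛ c (-d), x = μ * l) ∧ (∃ l ∈ bsΛ c (-d), x = α * l))) ∧
    ((∀ t : BSGroup c (-d), ∃ F : Finset (BSGroup c (-d)),
      (∀ α ∈ F, (∃ l ∈ bsΛ c (-d), α = t * l) ∧ α ∈ bsΛ c (-d)) ∧
      (∀ x : BSGroup c (-d), ((∃ l ∈ bsΛ c (-d), x = t * l) ∧ x ∈ bsΛ c (-d)) ↔
        ∃ α ∈ F, ∃ l ∈ bsΛ c (-d), x = α * l)) ↔ c = 1) ∧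
    (c = 1 →
      (∀ g : BSGroup c (-d),
        (∃ α ∈ bsΛ c (-d), ∃ β ∈ bsΛ c (-d), g = α * β⁻¹) ↔
        (g ∈ bsΛ c (-d) ∨ g⁻¹ ∈ bsΛ c (-d))) ∧
      (∀ t : BSGroup c (-d),
        (∃ x : BSGroup c (-d), (∃ l ∈ bsΛ c (-d), x = t * l) ∧ x ∈ bsΛ c (-d)) →
        ∃ α ∈ bsΛ c (-d), ∀ x : BSGroup c (-d),
          ((∃ l ∈ bsΛ c (-d), x = t * l) ∧ x ∈ bsΛ c (-d)) ↔
          ∃ l ∈ bsΛ c (-d), x = α * l)) := by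
  refine ⟨BaumslagSolitar.exhaustible hc hd,
    ⟨BaumslagSolitar.eq_one_of_finitelyAligned hc hd, ?_⟩, ?_⟩
  · rintro rfl
    exact BaumslagSolitar.finitelyAligned hd
  · rintro rfl
    exact ⟨BaumslagSolitar.mul_inv_mem_iff hd, BaumslagSolitar.exists_generator hd⟩
end

section
/- Assume case (BS2). There exist maps φ : [0, d)^ℕ → [0, d)^ℕ and r : [0, d)^ℕ → {0, 1}^ℕ such that for all i ∈ [0, d)^ℕ and all k ∈ ℕ, b^d α_k(φ(i)) = α_k(i) b^{c·r(i)_k} holds in Γ. Moreover, setting ℓ = inf{μ ≥ 1 : i_μ ≥ c} (with ℓ = ∞ if i_μ < c for all μ ≥ 1), one has r(i)_k = 1 if and only if k < ℓ; and φ is a homeomorphism of [0, d)^ℕ with the product topology (where [0, d) is discrete). -/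
/-- `[0, d)^ℕ`, the space of sequences with entries in `[0, d)`, carrying the product
topology (each factor `[0, d) ⊆ ℤ` being discrete). -/
abbrev BSSeq (d : ℤ) := ℕ → (Set.Ico (0 : ℤ) d)

/-- For `i ∈ [0,d)^ℕ` and `k ∈ ℕ`, the element `α_k(i) = b^{i₀} a b^{i₁} a ⋯ b^{i_k} a`. -/
def alphaSeq (c e d : ℤ) (i : BSSeq d) (k : ℕ) : BSGroup c e :=
  (List.ofFn (fun μ : Fin (k + 1) => bsb c e ^ ((i μ.1 : ℤ)) * bsa c e)).prod

namespace BSSeq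

section Twist

variable {X : Type*} (σ : Equiv.Perm X) (p : X → Prop)

open Classical in
/-- Apply `σ` to the entries of positive index of `i`, up to and including the first such entry
which fails `p`. -/
noncomputable def twist (i : ℕ → X) (m : ℕ) : X :=
  if 1 ≤ m ∧ ∀ n, 1 ≤ n → n < m → p (i n) then σ (i m) else i m

variable {σ p}

theorem twist_zero (i : ℕ → X) : twist σ p i 0 = i 0 := by simp [twist]

theorem twist_of_forall {i : ℕ → X} {m : ℕ} (hm : 1 ≤ m)
    (h : ∀ n, 1 ≤ n → n < m → p (i n)) : twist σ p i m = σ (i m) :=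
  if_pos ⟨hm, h⟩

theorem twist_of_not_forall {i : ℕ → X} {m : ℕ}
    (h : ¬ ∀ n, 1 ≤ n → n < m → p (i n)) : twist σ p i m = i m :=
  if_neg fun h' => h h'.2

theorem forall_twist_iff (i : ℕ → X) (m : ℕ) :
    (∀ n, 1 ≤ n → n < m → p (σ.symm (twist σ p i n))) ↔ ∀ n, 1 ≤ n → n < m → p (i n) := by
  induction m with
  | zero => simp
  | succ m ih =>
    simp only [Nat.lt_succ_iff_lt_or_eq, or_imp, forall_and] at ih ⊢
    rw [ih]
    refine and_congr_right fun h => ?_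
    refine forall_congr' fun n => forall_congr' fun hn => forall_congr' fun hnm => ?_
    subst hnm
    rw [twist_of_forall hn h, σ.symm_apply_apply]

theorem twist_symm_twist (i : ℕ → X) : twist σ.symm (p ∘ σ.symm) (twist σ p i) = i := by
  funext m
  rcases Nat.eq_zero_or_pos m with rfl | hm
  · simp only [twist_zero]
  · by_cases h : ∀ n, 1 ≤ n → n < m → p (i n)
    · rw [twist_of_forall (p := p ∘ σ.symm) hm ((forall_twist_iff (p := p) i m).2 h),
        twist_of_forall hm h, σ.symm_apply_apply]
    · rw [twist_of_not_forall (p := p ∘ σ.symm) (mt (forall_twist_iff (p := p) i m).1 h),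
        twist_of_not_forall h]

theorem twist_twist_symm (i : ℕ → X) : twist σ p (twist σ.symm (p ∘ σ.symm) i) = i := by
  simpa [Function.comp_def] using twist_symm_twist (σ := σ.symm) (p := p ∘ σ.symm) i

theorem continuous_twist [TopologicalSpace X] [DiscreteTopology X] :
    Continuous (twist σ p) := by
  classical
  refine continuous_pi fun m => ?_
  let g : (Fin (m + 1) → X) → X := fun x =>
    if 1 ≤ m ∧ ∀ n, 1 ≤ n → (h : n < m) → p (x ⟨n, h.trans m.lt_succ_self⟩)
      then σ (x (Fin.last m)) else x (Fin.last m)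
  have hg : Continuous g := continuous_of_discreteTopology
  have hr : Continuous fun (i : ℕ → X) (n : Fin (m + 1)) => i n :=
    continuous_pi fun n => continuous_apply _
  have hcomp := hg.comp hr
  convert hcomp using 1
  funext i
  simp only [twist, g, Function.comp_apply, Fin.val_last]
  congr

variable (σ p) in
/-- `twist` as a self-homeomorphism of a product of discrete spaces. -/
noncomputable def twistHomeomorph [TopologicalSpace X] [DiscreteTopology X] :
    (ℕ → X) ≃ₜ (ℕ → X) where
  toFun := twist σ p
  invFun := twist σ.symm (p ∘ σ.symm)
  left_inv := twist_symm_twist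
  right_inv := twist_twist_symm
  continuous_toFun := continuous_twist
  continuous_invFun := continuous_twist

end Twist

/-- Translation by `-c` modulo `d` on `[0, d)`. -/
def rotate (c d : ℤ) (hc : 0 ≤ c) (hcd : c ≤ d) : Equiv.Perm (Set.Ico (0 : ℤ) d) where
  toFun x := if h : (x : ℤ) < c then ⟨x + d - c, by have := x.2.1; constructor <;> omega⟩
    else ⟨x - c, by have := x.2.2; constructor <;> omega⟩
  invFun x := if h : (x : ℤ) < d - c then ⟨x + c, by have := x.2.1; constructor <;> omega⟩
    else ⟨x + c - d, by have := x.2.2; constructor <;> omega⟩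
  left_inv x := by
    obtain ⟨x, hx⟩ := x
    rw [Set.mem_Ico] at hx
    by_cases h : x < c
    · have h' : ¬ x + d - c < d - c := by omega
      simp [h, h']
    · have h' : x - c < d - c := by omega
      simp [h, h']
  right_inv x := by
    obtain ⟨x, hx⟩ := x
    rw [Set.mem_Ico] at hx
    by_cases h : x < d - c
    · have h' : ¬ x < 0 := by omega
      simp [h, h']
    · have h' : x + c - d < c := by omega
      simp [h, h']

theorem coe_rotate_of_lt {c d : ℤ} {hc : 0 ≤ c} {hcd : c ≤ d} {x : Set.Ico (0 : ℤ) d}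
    (h : (x : ℤ) < c) : (rotate c d hc hcd x : ℤ) = x + d - c := by
  simp [rotate, h]

theorem coe_rotate_of_not_lt {c d : ℤ} {hc : 0 ≤ c} {hcd : c ≤ d} {x : Set.Ico (0 : ℤ) d}
    (h : ¬ (x : ℤ) < c) : (rotate c d hc hcd x : ℤ) = x - c := by
  simp [rotate, h]

end BSSeq

theorem bsa_mul_bsb_zpow (c e : ℤ) : bsa c e * bsb c e ^ c = bsb c e ^ e * bsa c e := by
  have h := PresentedGroup.one_of_mem (rels := BSRel c e) (Set.mem_singleton _)
  rw [map_mul, map_inv, mul_inv_eq_one] at h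
  simp only [map_mul, map_zpow] at h
  exact h

theorem alphaSeq_zero (c e d : ℤ) (i : BSSeq d) :
    alphaSeq c e d i 0 = bsb c e ^ (i 0 : ℤ) * bsa c e := by
  simp [alphaSeq]

theorem alphaSeq_succ (c e d : ℤ) (i : BSSeq d) (k : ℕ) :
    alphaSeq c e d i (k + 1) =
      alphaSeq c e d i k * (bsb c e ^ (i (k + 1) : ℤ) * bsa c e) := by
  rw [alphaSeq, List.ofFn_succ', List.prod_concat]
  rfl

open Classical in
theorem bsb_zpow_mul_alphaSeq_twist {c d : ℤ} (hc : 0 ≤ c) (hcd : c ≤ d) (i : BSSeq d) (k : ℕ) :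
    bsb c d ^ d *
        alphaSeq c d d (BSSeq.twist (BSSeq.rotate c d hc hcd) (fun x => (x : ℤ) < c) i) k =
      alphaSeq c d d i k *
        bsb c d ^ (c * if ∀ m : ℕ, 1 ≤ m → m ≤ k → (i m : ℤ) < c then 1 else 0) := by
  induction k with
  | zero =>
    have h : ∀ m : ℕ, 1 ≤ m → m ≤ 0 → (i m : ℤ) < c := by omega
    rw [if_pos h, mul_one, alphaSeq_zero, alphaSeq_zero, BSSeq.twist_zero, mul_assoc,
      bsa_mul_bsb_zpow, ← mul_assoc, ← mul_assoc, ← zpow_add, ← zpow_add, add_comm]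
  | succ k ih =>
    rw [alphaSeq_succ, alphaSeq_succ, ← mul_assoc, ih, mul_assoc, mul_assoc]
    congr 1
    by_cases h : ∀ m : ℕ, 1 ≤ m → m ≤ k → (i m : ℤ) < c
    · rw [BSSeq.twist_of_forall (p := fun x : Set.Ico (0 : ℤ) d => (x : ℤ) < c) k.succ_pos
          fun m h1 h2 => h m h1 (Nat.lt_succ_iff.1 h2),
        if_pos h, mul_one, ← mul_assoc, ← zpow_add]
      by_cases hk : (i (k + 1) : ℤ) < c
      · have h' : ∀ m : ℕ, 1 ≤ m → m ≤ k + 1 → (i m : ℤ) < c := by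
          intro m h1 h2
          rcases Nat.le_succ_iff.1 h2 with h2 | rfl
          exacts [h m h1 h2, hk]
        rw [if_pos h', mul_one, BSSeq.coe_rotate_of_lt hk, mul_assoc, bsa_mul_bsb_zpow,
          ← mul_assoc, ← zpow_add]
        congr 2
        ring
      · rw [if_neg fun h' => hk (h' _ k.succ_pos le_rfl), mul_zero, zpow_zero, mul_one,
          BSSeq.coe_rotate_of_not_lt hk, add_sub_cancel]
    · rw [BSSeq.twist_of_not_forall (p := fun x : Set.Ico (0 : ℤ) d => (x : ℤ) < c)
          fun h' => h fun m h1 h2 => h' m h1 (Nat.lt_succ_iff.2 h2),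
        if_neg h, if_neg fun h' => h fun m h1 h2 => h' m h1 (h2.trans k.le_succ)]
      simp

/-- Case (BS2).  There are maps `φ : [0,d)^ℕ → [0,d)^ℕ` and `r : [0,d)^ℕ → {0,1}^ℕ` such
that `b^d α_k(φ(i)) = α_k(i) b^{c·r(i)_k}` for all `i, k`; with `ℓ = inf{μ ≥ 1 : i_μ ≥ c}`
(`ℓ = ∞` if there is no such `μ`), one has `r(i)_k = 1` iff `k < ℓ` (i.e. iff `i_μ < c`
for all `1 ≤ μ ≤ k`); and `φ` is a homeomorphism of `[0,d)^ℕ` with the product topology. -/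
theorem statement12 (c d : ℤ) (hc : 1 ≤ c) (hcd : c < d) :
    ∃ (φ : BSSeq d ≃ₜ BSSeq d) (r : BSSeq d → ℕ → ℤ),
      ∀ (i : BSSeq d) (k : ℕ),
        (r i k = 0 ∨ r i k = 1) ∧
        bsb c d ^ d * alphaSeq c d d (φ i) k = alphaSeq c d d i k * bsb c d ^ (c * r i k) ∧
        (r i k = 1 ↔ ∀ μ : ℕ, 1 ≤ μ → μ ≤ k → (i μ : ℤ) < c) := by
  classical
  have hc' : 0 ≤ c := by omega
  refine ⟨BSSeq.twistHomeomorph (BSSeq.rotate c d hc' hcd.le) fun x => (x : ℤ) < c,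
    fun i k => if ∀ m : ℕ, 1 ≤ m → m ≤ k → (i m : ℤ) < c then 1 else 0, fun i k => ⟨?_, ?_, ?_⟩⟩
  · exact (ite_eq_or_eq _ _ _).symm
  · convert bsb_zpow_mul_alphaSeq_twist hc' hcd.le i k using 1
    rfl
  · simp
end

section
/- Let C ⊆ Λ be a nonempty directed hereditary subset on which the height θ is bounded above. Then either C = [α] for some α ∈ Λ, or C = ⋃_{n∈ℕ} [α b^n] for some α ∈ Λ. -/
/-- An additive height on `Λ` is nonnegative, and its zero set consists of powers of `b`. -/
theorem bsΛ_height_nonneg_and_eq_pow {c e : ℤ}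
    (θ : BSGroup c e → ℤ) (hθ : ∀ x y, θ (x * y) = θ x + θ y)
    (hθa : θ (bsa c e) = 1) (hθb : θ (bsb c e) = 0) {x : BSGroup c e} (hx : x ∈ bsΛ c e) :
    0 ≤ θ x ∧ (θ x = 0 → ∃ n : ℕ, x = bsb c e ^ n) := by
  induction hx using Submonoid.closure_induction with
  | mem x hx =>
    rcases hx with rfl | rfl
    · simp [hθa]
    · exact ⟨hθb.ge, fun _ => ⟨1, (pow_one _).symm⟩⟩
  | one =>
    have h := hθ 1 1
    rw [one_mul] at h
    exact ⟨by omega, fun _ => ⟨0, (pow_zero _).symm⟩⟩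
  | mul x y _ _ ihx ihy =>
    rw [hθ]
    refine ⟨add_nonneg ihx.1 ihy.1, fun h => ?_⟩
    obtain ⟨m, rfl⟩ := ihx.2 (by have := ihx.1; have := ihy.1; omega)
    obtain ⟨n, rfl⟩ := ihy.2 (by have := ihx.1; have := ihy.1; omega)
    exact ⟨m + n, (pow_add _ _ _).symm⟩

/-- Let `C ⊆ Λ` be a nonempty directed hereditary subset on which the height `θ` is
bounded above.  Then either `C = [α]` for some `α ∈ Λ`, or `C = ⋃_{n∈ℕ} [α bⁿ]` for some
`α ∈ Λ`, where `[β] = {x ∈ Λ : β ∈ xΛ}`. -/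
theorem statement14 (c d : ℤ) (hc : 0 < c) (hd : 0 < d) (e : ℤ) (he : e = d ∨ e = -d)
    (θ : BSGroup c e → ℤ) (hθ : ∀ x y, θ (x * y) = θ x + θ y)
    (hθa : θ (bsa c e) = 1) (hθb : θ (bsb c e) = 0)
    (C : Set (BSGroup c e))
    (hCΛ : ∀ x ∈ C, x ∈ bsΛ c e)
    (hCne : C.Nonempty)
    (hdir : ∀ x ∈ C, ∀ y ∈ C, ∃ z ∈ C,
      (∃ γ ∈ bsΛ c e, z = x * γ) ∧ (∃ γ ∈ bsΛ c e, z = y * γ))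
    (hher : ∀ β ∈ C, ∀ α ∈ bsΛ c e, (∃ γ ∈ bsΛ c e, β = α * γ) → α ∈ C)
    (hbd : ∃ B : ℤ, ∀ x ∈ C, θ x ≤ B) :
    (∃ α ∈ bsΛ c e, C = {x | x ∈ bsΛ c e ∧ ∃ γ ∈ bsΛ c e, α = x * γ}) ∨
    (∃ α ∈ bsΛ c e, C = ⋃ n : ℕ,
      {x | x ∈ bsΛ c e ∧ ∃ γ ∈ bsΛ c e, α * bsb c e ^ n = x * γ}) := by
  have hbΛ (n : ℕ) : bsb c e ^ n ∈ bsΛ c e :=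
    pow_mem (Submonoid.subset_closure (by simp)) n
  obtain ⟨B, hB⟩ := hbd
  obtain ⟨x₀, hx₀⟩ := hCne
  obtain ⟨k, ⟨α, hα, rfl⟩, hmax⟩ := Int.exists_greatest_of_bdd (P := fun z => ∃ x ∈ C, θ x = z)
    ⟨B, by rintro _ ⟨x, hx, rfl⟩; exact hB x hx⟩ ⟨θ x₀, x₀, hx₀, rfl⟩
  have hαΛ := hCΛ α hα
  have hcof (x) (hx : x ∈ C) :
      ∃ n : ℕ, α * bsb c e ^ n ∈ C ∧ ∃ γ ∈ bsΛ c e, α * bsb c e ^ n = x * γ := by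
    obtain ⟨z, hz, ⟨γ, hγ, rfl⟩, hxz⟩ := hdir α hα x hx
    have hγ' := bsΛ_height_nonneg_and_eq_pow θ hθ hθa hθb hγ
    have hle := hmax _ ⟨_, hz, rfl⟩
    rw [hθ] at hle
    obtain ⟨n, rfl⟩ := hγ'.2 (by have := hγ'.1; omega)
    exact ⟨n, hz, hxz⟩
  have hext {m n : ℕ} (hmn : m ≤ n) :
      α * bsb c e ^ n = α * bsb c e ^ m * bsb c e ^ (n - m) := by
    rw [mul_assoc, ← pow_add, Nat.add_sub_cancel' hmn]
  by_cases hall : ∀ n : ℕ, α * bsb c e ^ n ∈ C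
  · refine Or.inr ⟨α, hαΛ, Set.ext fun x => ?_⟩
    simp only [Set.mem_iUnion, Set.mem_ofPred_eq]
    constructor
    · intro hx
      obtain ⟨n, -, h⟩ := hcof x hx
      exact ⟨n, hCΛ x hx, h⟩
    · rintro ⟨n, hx, h⟩
      exact hher _ (hall n) x hx h
  · push Not at hall
    obtain ⟨N, hN⟩ := hall
    have hlt (n : ℕ) (hn : α * bsb c e ^ n ∈ C) : n ≤ N := by
      by_contra! h
      exact hN (hher _ hn _ (mul_mem hαΛ (hbΛ N)) ⟨_, hbΛ _, hext h.le⟩)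
    classical
    set M := Nat.findGreatest (fun n => α * bsb c e ^ n ∈ C) N
    have hMC : α * bsb c e ^ M ∈ C :=
      Nat.findGreatest_spec (P := fun n => α * bsb c e ^ n ∈ C) (Nat.zero_le N) (by simpa using hα)
    refine Or.inl ⟨_, hCΛ _ hMC, Set.ext fun x => ⟨fun hx => ⟨hCΛ x hx, ?_⟩, ?_⟩⟩
    · obtain ⟨n, hn, γ, hγ, h⟩ := hcof x hx
      have hnM : n ≤ M := Nat.le_findGreatest (hlt n hn) hn
      exact ⟨γ * bsb c e ^ (M - n), mul_mem hγ (hbΛ _), by rw [hext hnM, h, mul_assoc]⟩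
    · rintro ⟨hx, h⟩
      exact hher _ hMC x hx h
end

section
/- Let i ∈ [0, d)^ℕ, and let C be a directed hereditary subset of Λ with C_0(i) ⊆ C. Then C = C_∞(i) if and only if b^n ∈ C for every n ∈ ℕ. -/
/-- `[β] = {x ∈ Λ : β ∈ xΛ}`, the set of initial segments of `β` lying in `Λ`. -/
def seg (c e : ℤ) (β : BSGroup c e) : Set (BSGroup c e) :=
  {x | x ∈ bsΛ c e ∧ ∃ γ ∈ bsΛ c e, β = x * γ}

/-- `C₀(i) = ⋃_k [α_k(i)]`. -/
def C0 (c e d : ℤ) (i : BSSeq d) : Set (BSGroup c e) :=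
  ⋃ k : ℕ, seg c e (alphaSeq c e d i k)

/-- `C_∞(i) = ⋃_{k,p} [α_k(i) bᵖ]`. -/
def Cinf (c e d : ℤ) (i : BSSeq d) : Set (BSGroup c e) :=
  ⋃ k : ℕ, ⋃ p : ℕ, seg c e (alphaSeq c e d i k * bsb c e ^ p)

/-- `C` is a nonempty directed hereditary subset of `Λ`: any two elements of `C` have a
common extension in `C`, and any initial segment (in `Λ`) of an element of `C` lies in
`C`. -/
def IsDH (c e : ℤ) (C : Set (BSGroup c e)) : Prop :=
  C.Nonempty ∧ (∀ x ∈ C, x ∈ bsΛ c e) ∧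
  (∀ x ∈ C, ∀ y ∈ C, ∃ z ∈ C,
    (∃ γ ∈ bsΛ c e, z = x * γ) ∧ (∃ γ ∈ bsΛ c e, z = y * γ)) ∧
  (∀ β ∈ C, ∀ α ∈ bsΛ c e, (∃ γ ∈ bsΛ c e, β = α * γ) → α ∈ C)

theorem bsa_mul_bsb_zpow_mul (c e n : ℤ) :
    bsa c e * bsb c e ^ (c * n) = bsb c e ^ (e * n) * bsa c e := by
  have h : SemiconjBy (bsa c e) (bsb c e ^ c) (bsb c e ^ e) := bsa_mul_bsb_zpow c e
  simpa only [zpow_mul] using (h.zpow_right n).eq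

theorem bsb_zpow_mul_bsa_mul_zpow (c e m q : ℤ) :
    bsb c e ^ m * bsa c e * bsb c e ^ (c * q) = bsb c e ^ (m + e * q) * bsa c e := by
  rw [mul_assoc, bsa_mul_bsb_zpow_mul, ← mul_assoc, ← zpow_add]

theorem bsa_mem (c e : ℤ) : bsa c e ∈ bsΛ c e :=
  Submonoid.subset_closure (Set.mem_insert _ _)

theorem bsb_mem (c e : ℤ) : bsb c e ∈ bsΛ c e :=
  Submonoid.subset_closure (Set.mem_insert_of_mem _ rfl)

theorem bsb_zpow_mem (c e : ℤ) {n : ℤ} (hn : 0 ≤ n) : bsb c e ^ n ∈ bsΛ c e := by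
  lift n to ℕ using hn
  rw [zpow_natCast]
  exact pow_mem (bsb_mem c e) n

/-- The homomorphism `Γ → ℤ` with `a ↦ 1` and `b ↦ 0`. -/
def bsHeight (c e : ℤ) : BSGroup c e →* Multiplicative ℤ :=
  PresentedGroup.toGroup (f := fun
    | BSGen.a => Multiplicative.ofAdd 1
    | BSGen.b => 1) (by
      rintro r rfl
      simp)

theorem bsHeight_bsa (c e : ℤ) : bsHeight c e (bsa c e) = Multiplicative.ofAdd 1 :=
  PresentedGroup.toGroup.of _

theorem bsHeight_bsb (c e : ℤ) : bsHeight c e (bsb c e) = 1 :=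
  PresentedGroup.toGroup.of _

theorem bsHeight_nonneg {c e : ℤ} {x : BSGroup c e} (hx : x ∈ bsΛ c e) :
    0 ≤ (bsHeight c e x).toAdd := by
  induction hx using Submonoid.closure_induction with
  | mem x hx =>
    rcases hx with rfl | rfl
    · simp [bsHeight_bsa]
    · simp [bsHeight_bsb]
  | one => simp
  | mul x y _ _ hx hy => simpa using add_nonneg hx hy

theorem bsHeight_bsb_zpow_mul_bsa_mul {c e : ℤ} (n : ℤ) (x : BSGroup c e) :
    (bsHeight c e (bsb c e ^ n * bsa c e * x)).toAdd = 1 + (bsHeight c e x).toAdd := by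
  simp [bsHeight_bsa, bsHeight_bsb]

theorem eq_bsb_zpow_or_of_mem {c e : ℤ} {x : BSGroup c e} (hx : x ∈ bsΛ c e) :
    ∃ n : ℤ, 0 ≤ n ∧ (x = bsb c e ^ n ∨ ∃ w ∈ bsΛ c e, x = bsb c e ^ n * bsa c e * w) := by
  induction hx using Submonoid.closure_induction_left with
  | one => exact ⟨0, le_rfl, by simp⟩
  | mul_left x hx y hy ih =>
    rcases hx with rfl | rfl
    · exact ⟨0, le_rfl, .inr ⟨y, hy, by simp⟩⟩
    · obtain ⟨n, hn, rfl | ⟨w, hw, rfl⟩⟩ := ih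
      · exact ⟨1 + n, by lia, .inl (by simp [zpow_add])⟩
      · exact ⟨1 + n, by lia, .inr ⟨w, hw, by simp [zpow_add, mul_assoc]⟩⟩

theorem injective_zpowGroupHom_multiplicative_int {n : ℤ} (hn : n ≠ 0) :
    Function.Injective (zpowGroupHom n : Multiplicative ℤ →* Multiplicative ℤ) := by
  intro x y h
  apply_fun Multiplicative.toAdd at h
  simpa [hn] using h

/-- The isomorphism `cℤ ≃ eℤ` along which `Γ` is an HNN extension of `ℤ`. -/
noncomputable def bsIso {c e : ℤ} (hc : c ≠ 0) (he : e ≠ 0) :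
    (zpowGroupHom c : Multiplicative ℤ →* Multiplicative ℤ).range ≃*
      (zpowGroupHom e : Multiplicative ℤ →* Multiplicative ℤ).range :=
  (MonoidHom.ofInjective (injective_zpowGroupHom_multiplicative_int hc)).symm.trans
    (MonoidHom.ofInjective (injective_zpowGroupHom_multiplicative_int he))

/-- The homomorphism from `Γ` to the HNN extension of `ℤ` along `cℤ ≃ eℤ`. -/
noncomputable def bsToHNN {c e : ℤ} (hc : c ≠ 0) (he : e ≠ 0) :
    BSGroup c e →* HNNExtension (Multiplicative ℤ) _ _ (bsIso hc he) :=
  PresentedGroup.toGroup (f := fun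
    | BSGen.a => HNNExtension.t
    | BSGen.b => HNNExtension.of (Multiplicative.ofAdd 1)) (by
      rintro r rfl
      have h := HNNExtension.t_mul_of (φ := bsIso hc he)
        (MonoidHom.ofInjective (injective_zpowGroupHom_multiplicative_int hc)
          (Multiplicative.ofAdd 1))
      simp only [bsIso, MulEquiv.trans_apply, MulEquiv.symm_apply_apply,
        MonoidHom.ofInjective_apply, zpowGroupHom_apply] at h
      simp only [map_mul, map_inv, map_zpow, FreeGroup.lift_apply_of, mul_inv_eq_one]
      rw [← map_zpow HNNExtension.of, ← map_zpow HNNExtension.of]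
      exact h)

theorem bsToHNN_bsa {c e : ℤ} (hc : c ≠ 0) (he : e ≠ 0) :
    bsToHNN hc he (bsa c e) = HNNExtension.t :=
  PresentedGroup.toGroup.of _

theorem bsToHNN_bsb {c e : ℤ} (hc : c ≠ 0) (he : e ≠ 0) :
    bsToHNN hc he (bsb c e) = HNNExtension.of (Multiplicative.ofAdd 1) :=
  PresentedGroup.toGroup.of _

theorem exists_positive_reducedWord {c e : ℤ} (hc : c ≠ 0) (he : e ≠ 0) {x : BSGroup c e}
    (hx : x ∈ bsΛ c e) :
    ∃ W : HNNExtension.NormalWord.ReducedWord (Multiplicative ℤ)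
        (zpowGroupHom c : Multiplicative ℤ →* Multiplicative ℤ).range
        (zpowGroupHom e : Multiplicative ℤ →* Multiplicative ℤ).range,
      (∀ p ∈ W.toList, p.1 = 1) ∧ W.prod (bsIso hc he) = bsToHNN hc he x := by
  induction hx using Submonoid.closure_induction_left with
  | one => exact ⟨.empty _ _ _, by simp [HNNExtension.NormalWord.ReducedWord.prod]⟩
  | mul_left x hx y hy ih =>
    obtain ⟨W, hW, h⟩ := ih
    rcases hx with rfl | rfl
    · refine ⟨⟨1, (1, W.head) :: W.toList, ?_⟩, ?_, ?_⟩
      · exact W.chain.cons fun p hp _ => (hW p (List.mem_of_mem_head? hp)).symm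
      · simpa using fun a b h => hW (a, b) h
      · rw [map_mul, ← h, bsToHNN_bsa]
        simp [HNNExtension.NormalWord.ReducedWord.prod, mul_assoc]
    · refine ⟨⟨Multiplicative.ofAdd 1 * W.head, W.toList, W.chain⟩, hW, ?_⟩
      rw [map_mul, ← h, bsToHNN_bsb]
      simp [HNNExtension.NormalWord.ReducedWord.prod, mul_assoc]

theorem dvd_sub_of_bsb_zpow_mul_bsa_mul_eq {c e : ℤ} (hc : c ≠ 0) (he : e ≠ 0) {m n : ℤ}
    {v w : BSGroup c e} (hv : v ∈ bsΛ c e) (hw : w ∈ bsΛ c e)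
    (h : bsb c e ^ m * bsa c e * v = bsb c e ^ n * bsa c e * w) : e ∣ n - m := by
  obtain ⟨V, hV, hVv⟩ := exists_positive_reducedWord hc he hv
  obtain ⟨W, hW, hWw⟩ := exists_positive_reducedWord hc he hw
  have key := HNNExtension.ReducedWord.map_fst_eq_and_of_prod_eq (bsIso hc he)
    (w₁ := ⟨.ofAdd m, (1, V.head) :: V.toList,
      V.chain.cons fun p hp _ => (hV p (List.mem_of_mem_head? hp)).symm⟩)
    (w₂ := ⟨.ofAdd n, (1, W.head) :: W.toList,
      W.chain.cons fun p hp _ => (hW p (List.mem_of_mem_head? hp)).symm⟩) (by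
      apply_fun bsToHNN hc he at h
      simp only [map_mul, map_zpow, bsToHNN_bsa, bsToHNN_bsb, ← hVv, ← hWw] at h
      simpa [HNNExtension.NormalWord.ReducedWord.prod, mul_assoc, ← map_zpow, ← ofAdd_zsmul]
        using h)
  obtain ⟨q, hq⟩ := key.2 1 (by simp)
  apply_fun Multiplicative.toAdd at hq
  refine ⟨q.toAdd, ?_⟩
  simp at hq
  lia

/-- The product `b^{i₀} a ⋯ b^{i_{k-1}} a` of the first `k` blocks of `i`. -/
def bsBlocks (c e : ℤ) {d : ℤ} (i : BSSeq d) (k : ℕ) : BSGroup c e :=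
  (List.ofFn (fun μ : Fin k => bsb c e ^ (i μ.1 : ℤ) * bsa c e)).prod

theorem bsBlocks_succ (c e : ℤ) {d : ℤ} (i : BSSeq d) (k : ℕ) :
    bsBlocks c e i (k + 1) =
      bsb c e ^ (i 0 : ℤ) * bsa c e * bsBlocks c e (fun n => i (n + 1)) k := by
  simp [bsBlocks, List.ofFn_succ]

theorem bsBlocks_succ_last (c e : ℤ) {d : ℤ} (i : BSSeq d) (k : ℕ) :
    bsBlocks c e i (k + 1) = bsBlocks c e i k * (bsb c e ^ (i k : ℤ) * bsa c e) := by
  rw [bsBlocks, List.ofFn_succ_last, List.prod_append]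
  simp [bsBlocks]

theorem bsBlocks_mem (c e : ℤ) {d : ℤ} (i : BSSeq d) (k : ℕ) :
    bsBlocks c e i k ∈ bsΛ c e := by
  induction k with
  | zero => simp [bsBlocks]
  | succ k ih =>
    rw [bsBlocks_succ_last]
    exact mul_mem ih (mul_mem (bsb_zpow_mem c e (i k).2.1) (bsa_mem c e))

theorem exists_bsBlocks_add (c e : ℤ) {d : ℤ} (i : BSSeq d) (k m : ℕ) :
    ∃ y ∈ bsΛ c e, bsBlocks c e i (k + m) = bsBlocks c e i k * y := by
  induction m with
  | zero => exact ⟨1, one_mem _, by simp⟩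
  | succ m ih =>
    obtain ⟨y, hy, h⟩ := ih
    refine ⟨y * (bsb c e ^ (i (k + m) : ℤ) * bsa c e),
      mul_mem hy (mul_mem (bsb_zpow_mem c e (i _).2.1) (bsa_mem c e)), ?_⟩
    rw [← add_assoc, bsBlocks_succ_last, h, mul_assoc]

/-- An element of height `k` that has a common extension with the first `k` blocks of `i` agrees
with them up to a power of `b`. -/
theorem exists_eq_bsBlocks_mul_zpow {c d e : ℤ} (hc : 0 < c) (hd : 0 < d)
    (he : e = d ∨ e = -d) (k : ℕ) (i : BSSeq d) {m : ℤ} (hm : e = d → 0 ≤ m)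
    {x u y : BSGroup c e} (hx : x ∈ bsΛ c e) (hu : u ∈ bsΛ c e) (hy : y ∈ bsΛ c e)
    (hk : (bsHeight c e x).toAdd = k)
    (h : bsb c e ^ m * x * u = bsBlocks c e i k * y) :
    ∃ q : ℤ, (e = d → 0 ≤ q) ∧ bsb c e ^ m * x = bsBlocks c e i k * bsb c e ^ q := by
  induction k generalizing i m x with
  | zero =>
    obtain ⟨n, hn, rfl | ⟨w, hw, rfl⟩⟩ := eq_bsb_zpow_or_of_mem hx
    · exact ⟨m + n, fun h => add_nonneg (hm h) hn, by simp [bsBlocks, zpow_add]⟩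
    · rw [bsHeight_bsb_zpow_mul_bsa_mul] at hk
      have := bsHeight_nonneg hw
      lia
  | succ k ih =>
    obtain ⟨n, hn, rfl | ⟨w, hw, rfl⟩⟩ := eq_bsb_zpow_or_of_mem hx
    · simp [bsHeight_bsb] at hk
      lia
    · rw [bsHeight_bsb_zpow_mul_bsa_mul] at hk
      have h' : bsb c e ^ (m + n) * bsa c e * (w * u) = bsb c e ^ (i 0 : ℤ) * bsa c e *
          (bsBlocks c e (fun n => i (n + 1)) k * y) := by
        rw [bsBlocks_succ] at h
        simpa only [zpow_add, mul_assoc] using h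
      obtain ⟨q, hq⟩ := dvd_sub_comm.1 (dvd_sub_of_bsb_zpow_mul_bsa_mul_eq hc.ne'
        (by lia) (mul_mem hw hu) (mul_mem (bsBlocks_mem c e _ k) hy) h')
      have hmove : bsb c e ^ (m + n) * bsa c e =
          bsb c e ^ (i 0 : ℤ) * bsa c e * bsb c e ^ (c * q) := by
        rw [bsb_zpow_mul_bsa_mul_zpow]
        congr 2
        lia
      have hq0 : e = d → 0 ≤ c * q := by
        rintro rfl
        have h1 := (i 0).2.2
        have h2 := hm rfl
        refine mul_nonneg hc.le ?_
        by_contra! hneg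
        nlinarith
      rw [hmove, mul_assoc, mul_right_inj] at h'
      obtain ⟨r, hr, h''⟩ := ih (fun n => i (n + 1)) hq0 hw (by push_cast at hk; lia)
        (by simpa only [mul_assoc] using h')
      refine ⟨r, hr, ?_⟩
      rw [bsBlocks_succ, mul_assoc _ _ (bsb c e ^ r), ← h'',
        ← mul_assoc _ (bsb c e ^ (c * q)) w, ← hmove]
      simp only [zpow_add, mul_assoc]

/-- A common extension of `k` blocks of `i` and a large power of `b` extends the blocks
followed by `bᵖ`. -/
theorem exists_zpow_forall_bsBlocks_extension {c d : ℤ} (hc : 0 < c) (hd : 0 < d) (p : ℤ)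
    (hp : 0 ≤ p) (k : ℕ) (i : BSSeq d) :
    ∃ N : ℤ, 0 ≤ N ∧ ∀ x ∈ bsΛ c d, ∀ y ∈ bsΛ c d, bsb c d ^ N * x = bsBlocks c d i k * y →
      ∃ w ∈ bsΛ c d, y = bsb c d ^ p * w := by
  induction k generalizing i with
  | zero => exact ⟨p, hp, fun x hx y _ h => ⟨x, hx, by simpa [bsBlocks] using h.symm⟩⟩
  | succ k ih =>
    obtain ⟨N, hN, H⟩ := ih (fun n => i (n + 1))
    refine ⟨i 0 + d * N, add_nonneg (i 0).2.1 (mul_nonneg hd.le hN), fun x hx y hy h => ?_⟩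
    rw [bsBlocks_succ] at h
    have hy' := mul_mem (bsBlocks_mem c d (fun n => i (n + 1)) k) hy
    obtain ⟨n, hn, rfl | ⟨w, hw, rfl⟩⟩ := eq_bsb_zpow_or_of_mem hx
    · apply_fun fun z => (bsHeight c d z).toAdd at h
      rw [mul_assoc _ _ y, bsHeight_bsb_zpow_mul_bsa_mul] at h
      have := bsHeight_nonneg hy'
      simp [bsHeight_bsb] at h this
      lia
    · have h' : bsb c d ^ (i 0 + d * N + n) * bsa c d * w = bsb c d ^ (i 0 : ℤ) * bsa c d *
          (bsBlocks c d (fun n => i (n + 1)) k * y) := by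
        simpa only [zpow_add, mul_assoc] using h
      obtain ⟨q, hq⟩ := dvd_sub_comm.1 (dvd_sub_of_bsb_zpow_mul_bsa_mul_eq hc.ne' hd.ne'
        hw hy' h')
      have hNq : N ≤ q := by
        by_contra! hlt
        nlinarith
      have hcq : N ≤ c * q := by nlinarith
      have hmove : bsb c d ^ (i 0 + d * N + n) * bsa c d =
          bsb c d ^ (i 0 : ℤ) * bsa c d * bsb c d ^ (c * q) := by
        rw [bsb_zpow_mul_bsa_mul_zpow]
        congr 2
        lia
      rw [hmove, mul_assoc, mul_right_inj] at h'
      refine H (bsb c d ^ (c * q - N) * w) (mul_mem (bsb_zpow_mem c d (by lia)) hw) y hy ?_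
      rw [← mul_assoc, ← zpow_add, ← h']
      congr 2
      lia

theorem mem_Cinf_of_extension {c e d : ℤ} {i : BSSeq d} {k p : ℕ} {x γ : BSGroup c e}
    (hx : x ∈ bsΛ c e) (hγ : γ ∈ bsΛ c e)
    (h : bsBlocks c e i (k + 1) * bsb c e ^ p = x * γ) : x ∈ Cinf c e d i :=
  Set.mem_iUnion.2 ⟨k, Set.mem_iUnion.2 ⟨p, hx, γ, hγ, h⟩⟩

theorem bsb_pow_mem_Cinf {c e d : ℤ} (hc : 0 < c) (hd : 0 < d) (he : e = d ∨ e = -d)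
    (i : BSSeq d) (n : ℕ) : bsb c e ^ n ∈ Cinf c e d i := by
  have hb := pow_mem (bsb_mem c e) n
  have hi := (i 0).2.1
  have hn : (0 : ℤ) ≤ (d - 1) * n := mul_nonneg (by lia) (by lia)
  have hmem : bsb c e ^ ((i 0 : ℤ) + (d - 1) * n) * bsa c e ∈ bsΛ c e :=
    mul_mem (bsb_zpow_mem c e (by lia)) (bsa_mem c e)
  have hone : bsBlocks c e i 1 = bsb c e ^ (i 0 : ℤ) * bsa c e := by simp [bsBlocks]
  rcases he with rfl | rfl
  · refine mem_Cinf_of_extension (k := 0) (p := (c * n).toNat) hb hmem ?_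
    rw [zero_add, hone, ← zpow_natCast, Int.toNat_of_nonneg (by positivity),
      bsb_zpow_mul_bsa_mul_zpow, ← zpow_natCast, ← mul_assoc, ← zpow_add]
    congr 2
    ring
  · refine mem_Cinf_of_extension (k := 0) (p := 0) hb
      (mul_mem hmem (bsb_zpow_mem c (-d) (n := c * n) (by positivity))) ?_
    rw [zero_add, hone, bsb_zpow_mul_bsa_mul_zpow, ← zpow_natCast (bsb c (-d)) n, ← mul_assoc,
      ← zpow_add, pow_zero, mul_one]
    congr 2
    ring

theorem subset_Cinf {c d e : ℤ} (hc : 0 < c) (hd : 0 < d) (he : e = d ∨ e = -d)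
    {i : BSSeq d} {C : Set (BSGroup c e)} (hC : IsDH c e C) (h0 : C0 c e d i ⊆ C) :
    C ⊆ Cinf c e d i := by
  intro x hxC
  obtain ⟨-, hΛ, hdir, -⟩ := hC
  have hx := hΛ x hxC
  obtain ⟨k, hk⟩ := Int.eq_ofNat_of_zero_le (bsHeight_nonneg hx)
  have hα : bsBlocks c e i (k + 1) ∈ C :=
    h0 (Set.mem_iUnion.2 ⟨k, bsBlocks_mem c e i _, 1, one_mem _, (mul_one _).symm⟩)
  obtain ⟨z, -, ⟨u, hu, rfl⟩, ⟨v, hv, h⟩⟩ := hdir x hxC _ hα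
  obtain ⟨y, hy, hsplit⟩ := exists_bsBlocks_add c e i k 1
  obtain ⟨q, hq, hxq⟩ := exists_eq_bsBlocks_mul_zpow hc hd he k i (m := 0) (fun _ => le_rfl)
    hx hu (mul_mem hy hv) hk (by rw [zpow_zero, one_mul, h, hsplit, mul_assoc])
  rw [zpow_zero, one_mul] at hxq
  cases k with
  | zero =>
    obtain ⟨n, hn, rfl | ⟨w, hw, rfl⟩⟩ := eq_bsb_zpow_or_of_mem hx
    · lift n to ℕ using hn
      simpa using bsb_pow_mem_Cinf hc hd he i n
    · rw [bsHeight_bsb_zpow_mul_bsa_mul] at hk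
      have := bsHeight_nonneg hw
      lia
  | succ k =>
    rcases le_total 0 q with hq0 | hq0
    · lift q to ℕ using hq0
      exact mem_Cinf_of_extension (k := k) (p := q) hx (one_mem _) (by simp [hxq])
    · exact mem_Cinf_of_extension (k := k) (p := 0) hx (bsb_zpow_mem c e (neg_nonneg.2 hq0))
        (by simp [hxq])

theorem bsBlocks_mul_pow_mem {c d e : ℤ} (hc : 0 < c) (hd : 0 < d) (he : e = d ∨ e = -d)
    {i : BSSeq d} {C : Set (BSGroup c e)} (hC : IsDH c e C) (h0 : C0 c e d i ⊆ C)
    (hb : ∀ n : ℕ, bsb c e ^ n ∈ C) (k p : ℕ) :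
    bsBlocks c e i (k + 1) * bsb c e ^ p ∈ C := by
  obtain ⟨-, -, hdir, hher⟩ := hC
  have hα : ∀ k, bsBlocks c e i (k + 1) ∈ C := fun k =>
    h0 (Set.mem_iUnion.2 ⟨k, bsBlocks_mem c e i _, 1, one_mem _, (mul_one _).symm⟩)
  have hmem := mul_mem (bsBlocks_mem c e i (k + 1)) (pow_mem (bsb_mem c e) p)
  rcases he with rfl | rfl
  · obtain ⟨N, hN, H⟩ := exists_zpow_forall_bsBlocks_extension hc hd p (by lia) (k + 1) i
    lift N to ℕ using hN
    obtain ⟨z, hz, ⟨x, hx, rfl⟩, ⟨y, hy, h⟩⟩ := hdir _ (hb N) _ (hα k)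
    obtain ⟨w, hw, rfl⟩ := H x hx y hy (by simpa using h)
    refine hher _ hz _ hmem ⟨w, hw, ?_⟩
    rw [h, mul_assoc, zpow_natCast]
  · have hi := (i (k + 1)).2.1
    have hp : (0 : ℤ) ≤ (d - 1) * p := mul_nonneg (by lia) (by lia)
    refine hher _ (hα (k + 1)) _ hmem
      ⟨bsb c (-d) ^ ((i (k + 1) : ℤ) + (d - 1) * p) * bsa c (-d) * bsb c (-d) ^ (c * p),
        mul_mem (mul_mem (bsb_zpow_mem _ _ (by lia)) (bsa_mem _ _))
          (bsb_zpow_mem _ _ (by positivity)), ?_⟩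
    rw [bsBlocks_succ_last _ _ _ (k + 1), bsb_zpow_mul_bsa_mul_zpow, mul_assoc,
      ← zpow_natCast (bsb c (-d)) p, ← mul_assoc (bsb c (-d) ^ (p : ℤ)), ← zpow_add]
    congr 3
    ring

/-- Let `i ∈ [0,d)^ℕ` and let `C` be a directed hereditary subset of `Λ` with
`C₀(i) ⊆ C`.  Then `C = C_∞(i)` iff `bⁿ ∈ C` for every `n ∈ ℕ`. -/
theorem statement16 (c d : ℤ) (hc : 0 < c) (hd : 0 < d) (e : ℤ) (he : e = d ∨ e = -d)
    (i : BSSeq d) (C : Set (BSGroup c e)) (hC : IsDH c e C) (h0 : C0 c e d i ⊆ C) :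
    C = Cinf c e d i ↔ ∀ n : ℕ, bsb c e ^ n ∈ C := by
  refine ⟨fun h n => h ▸ bsb_pow_mem_Cinf hc hd he i n, fun hb => ?_⟩
  refine (subset_Cinf hc hd he hC h0).antisymm fun x hx => ?_
  simp only [Cinf, Set.mem_iUnion] at hx
  obtain ⟨k, p, hxΛ, γ, hγ, h⟩ := hx
  exact hC.2.2.2 _ (bsBlocks_mul_pow_mem hc hd he hC h0 hb k p) x hxΛ ⟨γ, hγ, h⟩
end

section
/- Assume case (BS1). Let i ∈ [0, d)^ℕ and let C be a directed hereditary subset of Λ with C_0(i) ⊆ C and C ≠ C_∞(i) (so C ⊊ C_∞(i)). Then there exists a sequence n = (n_0, n_1, …) of nonnegative integers satisfying, for all ℓ ≥ 1, (c·n_{ℓ−1} − i_ℓ)/d ≤ n_ℓ < (c·(n_{ℓ−1} + 1) − i_ℓ)/d, such that C = ⋃_{ℓ≥0} [α_{ℓ−1}(i) b^{n_ℓ·d + i_ℓ}], where α_{−1}(i) denotes the identity of Γ. -/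
/-- For `i ∈ [0,d)^ℕ` and `ℓ ∈ ℕ`, the element `α_{ℓ-1}(i) = b^{i₀} a ⋯ b^{i_{ℓ-1}} a`
(the empty product, i.e. the identity, when `ℓ = 0`). -/
def alphaPre (c e d : ℤ) (i : BSSeq d) (ℓ : ℕ) : BSGroup c e :=
  (List.ofFn (fun μ : Fin ℓ => bsb c e ^ ((i μ.1 : ℤ)) * bsa c e)).prod

/-- The isomorphism `cℤ ≃ dℤ`, `c ↦ d`, between subgroups of (multiplicative) `ℤ`. -/
noncomputable def zpowRangeEquiv (c d : ℤ) (hc : c ≠ 0) (hd : d ≠ 0) :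
    (zpowGroupHom c : Multiplicative ℤ →* Multiplicative ℤ).range ≃*
      (zpowGroupHom d : Multiplicative ℤ →* Multiplicative ℤ).range :=
  (MonoidHom.ofInjective (zpow_left_injective hc)).symm.trans
    (MonoidHom.ofInjective (zpow_left_injective hd))

theorem zpowRangeEquiv_coe (c d : ℤ) (hc : c ≠ 0) (hd : d ≠ 0) (x : Multiplicative ℤ) :
    (zpowRangeEquiv c d hc hd ⟨x ^ c, x, rfl⟩ : Multiplicative ℤ) = x ^ d := by
  have h : (⟨x ^ c, x, rfl⟩ : (zpowGroupHom c : Multiplicative ℤ →* Multiplicative ℤ).range) =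
      MonoidHom.ofInjective (f := (zpowGroupHom c : Multiplicative ℤ →* Multiplicative ℤ))
        (zpow_left_injective hc) x := rfl
  rw [h, zpowRangeEquiv, MulEquiv.trans_apply, MulEquiv.symm_apply_apply]
  rfl

/-- A homomorphism out of the Baumslag–Solitar group. -/
def bsLift {H : Type*} [Group H] (c e : ℤ) (x y : H) (h : x * y ^ c = y ^ e * x) :
    BSGroup c e →* H :=
  PresentedGroup.toGroup (f := fun s => BSGen.casesOn s x y) (by
    rintro r rfl
    simp [h])

theorem bsLift_a {H : Type*} [Group H] (c e : ℤ) (x y : H) (h : x * y ^ c = y ^ e * x) :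
    bsLift c e x y h (bsa c e) = x :=
  PresentedGroup.toGroup.of _

theorem bsLift_b {H : Type*} [Group H] (c e : ℤ) (x y : H) (h : x * y ^ c = y ^ e * x) :
    bsLift c e x y h (bsb c e) = y :=
  PresentedGroup.toGroup.of _

theorem bsΛ_eq_bsb_zpow_or (c e : ℤ) {x : BSGroup c e} (hx : x ∈ bsΛ c e) :
    ∃ j : ℤ, 0 ≤ j ∧
      (x = bsb c e ^ j ∨ ∃ y ∈ bsΛ c e, x = bsb c e ^ j * (bsa c e * y)) := by
  induction hx using Submonoid.closure_induction_left with
  | one => exact ⟨0, le_rfl, Or.inl (by simp)⟩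
  | mul_left g hg y hy ih =>
    rcases hg with rfl | rfl
    · exact ⟨0, le_rfl, Or.inr ⟨y, hy, by simp⟩⟩
    · obtain ⟨j, hj, rfl | ⟨z, hz, rfl⟩⟩ := ih
      · exact ⟨1 + j, by omega, Or.inl (by rw [zpow_one_add])⟩
      · exact ⟨1 + j, by omega, Or.inr ⟨z, hz, by rw [zpow_one_add, mul_assoc]⟩⟩

/-- No power of `b` has an initial segment `bᵖ a` in `Λ`. -/
theorem bsb_zpow_ne (c e : ℤ) {p q : ℤ} {x : BSGroup c e} (hx : x ∈ bsΛ c e) :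
    bsb c e ^ p ≠ bsb c e ^ q * (bsa c e * x) := by
  intro h
  let χ : BSGroup c e →* Multiplicative ℤ := bsLift c e (Multiplicative.ofAdd 1) 1 (by simp)
  have ha : χ (bsa c e) = Multiplicative.ofAdd 1 := bsLift_a ..
  have hb : χ (bsb c e) = 1 := bsLift_b ..
  have hχ : 0 ≤ (χ x).toAdd := by
    clear h
    induction hx using Submonoid.closure_induction with
    | mem y hy => rcases hy with rfl | rfl <;> simp [ha, hb]
    | one => simp
    | mul y z _ _ hy hz => simpa using add_nonneg hy hz
  have h' := congrArg (fun y => (χ y).toAdd) h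
  simp [ha, hb] at h'
  omega

open HNNExtension in
theorem exists_reducedWord_of_mem_bsΛ {G : Type*} [Group G] {A B : Subgroup G} (φ : A ≃* B)
    (c e : ℤ) (F : BSGroup c e →* HNNExtension G A B φ) (g : G) (ha : F (bsa c e) = t)
    (hb : F (bsb c e) = of g) {x : BSGroup c e} (hx : x ∈ bsΛ c e) :
    ∃ w : NormalWord.ReducedWord G A B, (∀ u ∈ w.toList, u.1 = 1) ∧ w.prod φ = F x := by
  induction hx using Submonoid.closure_induction_left with
  | one => exact ⟨NormalWord.ReducedWord.empty G A B, by simp,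
      by simp [NormalWord.ReducedWord.prod]⟩
  | mul_left s hs y _ ih =>
    obtain ⟨w, hw, hwp⟩ := ih
    rcases hs with rfl | rfl
    · refine ⟨⟨1, (1, w.head) :: w.toList, ?_⟩, ?_, ?_⟩
      · refine List.isChain_cons.2 ⟨fun u hu _ => ?_, w.chain⟩
        exact (hw u (List.mem_of_mem_head? hu)).symm
      · simpa using fun a b hab => hw (a, b) hab
      · rw [map_mul, ← hwp, ha]
        simp [NormalWord.ReducedWord.prod, mul_assoc]
    · refine ⟨⟨g * w.head, w.toList, w.chain⟩, hw, ?_⟩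
      rw [map_mul, ← hwp, hb]
      simp [NormalWord.ReducedWord.prod, mul_assoc]

open HNNExtension in
/-- The exponent of the first power of `b` in a positive word containing `a` is determined
modulo `d`. -/
theorem dvd_sub_of_bsb_zpow_mul_eq {c d : ℤ} (hc : c ≠ 0) (hd : d ≠ 0) {p q : ℤ}
    {x y : BSGroup c d} (hx : x ∈ bsΛ c d) (hy : y ∈ bsΛ c d)
    (h : bsb c d ^ p * (bsa c d * x) = bsb c d ^ q * (bsa c d * y)) : d ∣ q - p := by
  let φ := zpowRangeEquiv c d hc hd
  let g : Multiplicative ℤ := Multiplicative.ofAdd 1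
  have hrel : (t : HNNExtension _ _ _ φ) * of g ^ c = of g ^ d * t := by
    have h := t_mul_of (φ := φ) ⟨g ^ c, g, rfl⟩
    rw [zpowRangeEquiv_coe] at h
    simpa only [map_zpow] using h
  let F := bsLift c d _ _ hrel
  have ha : F (bsa c d) = t := bsLift_a ..
  have hb : F (bsb c d) = of g := bsLift_b ..
  obtain ⟨v, hv, hvp⟩ := exists_reducedWord_of_mem_bsΛ φ c d F g ha hb hx
  obtain ⟨w, hw, hwp⟩ := exists_reducedWord_of_mem_bsΛ φ c d F g ha hb hy
  let v' : NormalWord.ReducedWord (Multiplicative ℤ) _ _ :=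
    ⟨g ^ p, (1, v.head) :: v.toList, List.isChain_cons.2
      ⟨fun u hu _ => (hv u (List.mem_of_mem_head? hu)).symm, v.chain⟩⟩
  let w' : NormalWord.ReducedWord (Multiplicative ℤ) _ _ :=
    ⟨g ^ q, (1, w.head) :: w.toList, List.isChain_cons.2
      ⟨fun u hu _ => (hw u (List.mem_of_mem_head? hu)).symm, w.chain⟩⟩
  have hprod : v'.prod φ = w'.prod φ := by
    have h' := congrArg F h
    simp only [map_mul, map_zpow, ha, hb, ← hvp, ← hwp] at h'
    simpa [v', w', NormalWord.ReducedWord.prod, mul_assoc] using h'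
  have hmem := (ReducedWord.map_fst_eq_and_of_prod_eq φ hprod).2 1 (by simp [v'])
  obtain ⟨z, hz⟩ := hmem
  have hz' := congrArg Multiplicative.toAdd hz
  simp [v', w', g] at hz'
  exact ⟨z.toAdd, by omega⟩

theorem alphaPre_succ (c e d : ℤ) (i : BSSeq d) (ℓ : ℕ) :
    alphaPre c e d i (ℓ + 1) =
      alphaPre c e d i ℓ * (bsb c e ^ (i ℓ : ℤ) * bsa c e) := by
  rw [alphaPre, List.ofFn_succ', List.concat_eq_append, List.prod_append, List.prod_singleton]
  rfl

theorem alphaPre_mem_bsΛ (c e d : ℤ) (i : BSSeq d) (ℓ : ℕ) :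
    alphaPre c e d i ℓ ∈ bsΛ c e := by
  induction ℓ with
  | zero => simp [alphaPre]
  | succ ℓ ih =>
    rw [alphaPre_succ]
    exact mul_mem ih (mul_mem (bsb_zpow_mem c e (i ℓ).2.1) (bsa_mem c e))

theorem alphaPre_succ_mul_bsb_zpow (c d : ℤ) (i : BSSeq d) (ℓ : ℕ) (n : ℤ) :
    alphaPre c d d i (ℓ + 1) * bsb c d ^ (c * n) =
      alphaPre c d d i ℓ * bsb c d ^ (d * n + (i ℓ : ℤ)) * bsa c d := by
  rw [alphaPre_succ, mul_assoc, mul_assoc, bsa_mul_bsb_zpow_mul, add_comm (d * n), zpow_add]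
  simp only [mul_assoc]

theorem alphaPre_mem_of_C0_subset {c d : ℤ} {i : BSSeq d} {C : Set (BSGroup c d)}
    (h0 : C0 c d d i ⊆ C) (ℓ : ℕ) : alphaPre c d d i ℓ ∈ C :=
  h0 (Set.mem_iUnion.2 ⟨ℓ, alphaPre_mem_bsΛ c d d i ℓ, _,
    mul_mem (bsb_zpow_mem c d (i ℓ).2.1) (bsa_mem c d), alphaPre_succ c d d i ℓ⟩)

namespace IsDH

variable {c d : ℤ} {i : BSSeq d} {C : Set (BSGroup c d)}

theorem mem_of_mul (hC : IsDH c d C) {x y : BSGroup c d} (hx : x ∈ bsΛ c d)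
    (hy : y ∈ bsΛ c d) (h : x * y ∈ C) : x ∈ C :=
  hC.2.2.2 _ h x hx ⟨y, hy, rfl⟩

theorem alphaPre_mul_zpow_mono (hC : IsDH c d C) {ℓ : ℕ} {p q : ℤ} (hp : 0 ≤ p) (hpq : p ≤ q)
    (h : alphaPre c d d i ℓ * bsb c d ^ q ∈ C) : alphaPre c d d i ℓ * bsb c d ^ p ∈ C := by
  refine hC.mem_of_mul (y := bsb c d ^ (q - p))
    (mul_mem (alphaPre_mem_bsΛ c d d i ℓ) (bsb_zpow_mem c d hp)) (bsb_zpow_mem c d (by omega)) ?_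
  rwa [mul_assoc, ← zpow_add, add_sub_cancel]

/-- An element of `C` extending `α_{ℓ-1}(i)` has an extension in `C` that also extends
`α_ℓ(i)`. -/
theorem exists_mul_eq (hC : IsDH c d C) (h0 : C0 c d d i ⊆ C) {ℓ : ℕ} {y : BSGroup c d}
    (h : alphaPre c d d i ℓ * y ∈ C) :
    ∃ γ ∈ bsΛ c d, ∃ δ ∈ bsΛ c d, y * γ = bsb c d ^ (i ℓ : ℤ) * (bsa c d * δ) ∧
      alphaPre c d d i ℓ * (y * γ) ∈ C := by
  obtain ⟨z, hz, ⟨γ, hγ, hzγ⟩, δ, hδ, hzδ⟩ :=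
    hC.2.2.1 _ h _ (alphaPre_mem_of_C0_subset h0 (ℓ + 1))
  refine ⟨γ, hγ, δ, hδ, ?_, by rwa [← mul_assoc, ← hzγ]⟩
  rw [hzγ, alphaPre_succ] at hzδ
  simpa only [mul_assoc, mul_right_inj] using hzδ

theorem exists_le (hC : IsDH c d C) (h0 : C0 c d d i ⊆ C) (hc : c ≠ 0) (hd : 0 < d) {ℓ : ℕ}
    {q : ℤ} (hq : 0 ≤ q) (h : alphaPre c d d i ℓ * bsb c d ^ q ∈ C) :
    ∃ n : ℤ, 0 ≤ n ∧ q ≤ d * n + i ℓ ∧ alphaPre c d d i (ℓ + 1) * bsb c d ^ (c * n) ∈ C := by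
  obtain ⟨γ, hγ, δ, hδ, hγδ, hmem⟩ := hC.exists_mul_eq h0 h
  obtain ⟨j, hj, rfl | ⟨γ', hγ', rfl⟩⟩ := bsΛ_eq_bsb_zpow_or c d hγ
  · rw [← zpow_add] at hγδ
    exact absurd hγδ (bsb_zpow_ne c d hδ)
  · rw [← mul_assoc, ← zpow_add] at hγδ
    rw [← mul_assoc (bsb c d ^ q), ← zpow_add] at hmem
    obtain ⟨m, hm⟩ := dvd_sub_of_bsb_zpow_mul_eq hc hd.ne' hδ hγ' hγδ.symm
    have hi := (i ℓ).2.2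
    have hqj : q + j = d * m + i ℓ := by omega
    have hm0 : 0 ≤ m := by
      by_contra hm'
      have : d * m ≤ d * (-1) := mul_le_mul_of_nonneg_left (by omega) hd.le
      omega
    refine ⟨m, hm0, by omega, ?_⟩
    rw [alphaPre_succ_mul_bsb_zpow, ← hqj]
    refine hC.mem_of_mul (y := γ') (mul_mem (mul_mem (alphaPre_mem_bsΛ c d d i ℓ)
      (bsb_zpow_mem c d (by omega))) (bsa_mem c d)) hγ' ?_
    simpa only [mul_assoc] using hmem

theorem alphaPre_mul_zpow_iff (hC : IsDH c d C) (h0 : C0 c d d i ⊆ C) (hc : 0 < c) (hd : 0 < d)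
    {ℓ : ℕ} {n : ℤ} (hn : 0 ≤ n) :
    alphaPre c d d i (ℓ + 1) * bsb c d ^ (c * n) ∈ C ↔
      alphaPre c d d i ℓ * bsb c d ^ (d * n + (i ℓ : ℤ)) ∈ C := by
  have hi := (i ℓ).2.1
  have hdn : 0 ≤ d * n := by positivity
  refine ⟨fun h => ?_, fun h => ?_⟩
  · rw [alphaPre_succ_mul_bsb_zpow] at h
    exact hC.mem_of_mul (mul_mem (alphaPre_mem_bsΛ c d d i ℓ) (bsb_zpow_mem c d (by omega)))
      (bsa_mem c d) h
  · obtain ⟨m, hm, hnm, hmem⟩ := hC.exists_le h0 hc.ne' hd (by omega) h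
    have hnm' : n ≤ m := le_of_mul_le_mul_left (by omega) hd
    exact hC.alphaPre_mul_zpow_mono (by positivity) (by gcongr) hmem

theorem exists_eq_of_mul_mem (hC : IsDH c d C) (h0 : C0 c d d i ⊆ C) (hc : 0 < c) (hd : 0 < d)
    {x : BSGroup c d} (hx : x ∈ bsΛ c d) (ℓ : ℕ) {p : ℤ} (hp : 0 ≤ p)
    (h : alphaPre c d d i ℓ * (bsb c d ^ p * x) ∈ C) :
    ∃ (m : ℕ) (q : ℤ), 0 ≤ q ∧
      alphaPre c d d i ℓ * (bsb c d ^ p * x) = alphaPre c d d i m * bsb c d ^ q := by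
  induction hx using Submonoid.closure_induction_left generalizing ℓ p with
  | one => exact ⟨ℓ, p, hp, by simp⟩
  | mul_left s hs y hy ih =>
    rcases hs with rfl | rfl
    · obtain ⟨γ, hγ, δ, hδ, hγδ, -⟩ := hC.exists_mul_eq h0 h
      simp only [mul_assoc] at hγδ
      obtain ⟨n, hn⟩ := dvd_sub_of_bsb_zpow_mul_eq hc.ne' hd.ne' hδ (mul_mem hy hγ) hγδ.symm
      have hi := (i ℓ).2.2
      have hp' : p = d * n + i ℓ := by omega
      have hn0 : 0 ≤ n := by
        by_contra hn'
        have : d * n ≤ d * (-1) := mul_le_mul_of_nonneg_left (by omega) hd.le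
        omega
      have key : alphaPre c d d i ℓ * (bsb c d ^ p * (bsa c d * y)) =
          alphaPre c d d i (ℓ + 1) * (bsb c d ^ (c * n) * y) := by
        rw [← mul_assoc (alphaPre c d d i (ℓ + 1)), alphaPre_succ_mul_bsb_zpow, hp']
        simp only [mul_assoc]
      rw [key] at h ⊢
      exact ih (ℓ + 1) (by positivity) h
    · have key : bsb c d ^ p * (bsb c d * y) = bsb c d ^ (p + 1) * y := by
        rw [zpow_add_one, mul_assoc]
      rw [key] at h ⊢
      exact ih ℓ (by omega) h

theorem exists_eq (hC : IsDH c d C) (h0 : C0 c d d i ⊆ C) (hc : 0 < c) (hd : 0 < d)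
    {x : BSGroup c d} (hx : x ∈ C) :
    ∃ (m : ℕ) (q : ℤ), 0 ≤ q ∧ x = alphaPre c d d i m * bsb c d ^ q := by
  simpa [alphaPre] using
    hC.exists_eq_of_mul_mem (i := i) h0 hc hd (hC.2.1 x hx) 0 le_rfl (by simpa [alphaPre])

theorem forall_zpow_succ_iff (hC : IsDH c d C) (h0 : C0 c d d i ⊆ C) (hc : 0 < c) (hd : 0 < d)
    (ℓ : ℕ) :
    (∀ q : ℤ, 0 ≤ q → alphaPre c d d i (ℓ + 1) * bsb c d ^ q ∈ C) ↔
      ∀ q : ℤ, 0 ≤ q → alphaPre c d d i ℓ * bsb c d ^ q ∈ C := by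
  have hi := (i ℓ).2.1
  refine ⟨fun h q hq => ?_, fun h q hq => ?_⟩
  · refine hC.alphaPre_mul_zpow_mono hq ?_
      ((hC.alphaPre_mul_zpow_iff h0 hc hd hq).1 (h _ (by positivity)))
    nlinarith
  · refine hC.alphaPre_mul_zpow_mono hq ?_
      ((hC.alphaPre_mul_zpow_iff h0 hc hd hq).2 (h _ (by positivity)))
    nlinarith

theorem subset_Cinf (hC : IsDH c d C) (h0 : C0 c d d i ⊆ C) (hc : 0 < c) (hd : 0 < d) :
    C ⊆ Cinf c d d i := by
  intro x hx
  obtain ⟨m, q, hq, rfl⟩ := hC.exists_eq h0 hc hd hx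
  have hi := (i m).2.1
  refine Set.mem_iUnion₂.2 ⟨m, (c * q).toNat, hC.2.1 _ hx,
    bsb c d ^ (d * q + i m - q) * bsa c d,
    mul_mem (bsb_zpow_mem c d (by nlinarith)) (bsa_mem c d), ?_⟩
  have h := alphaPre_succ_mul_bsb_zpow c d i m q
  rw [← zpow_natCast, Int.toNat_of_nonneg (by positivity)]
  refine h.trans ?_
  rw [← mul_assoc, mul_assoc (alphaPre c d d i m) (bsb c d ^ q), ← zpow_add, add_sub_cancel]

theorem eq_Cinf (hC : IsDH c d C) (h0 : C0 c d d i ⊆ C) (hc : 0 < c) (hd : 0 < d) (ℓ : ℕ)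
    (h : ∀ q : ℤ, 0 ≤ q → alphaPre c d d i ℓ * bsb c d ^ q ∈ C) : C = Cinf c d d i := by
  have iff_zero : ∀ m : ℕ, (∀ q : ℤ, 0 ≤ q → alphaPre c d d i m * bsb c d ^ q ∈ C) ↔
      ∀ q : ℤ, 0 ≤ q → alphaPre c d d i 0 * bsb c d ^ q ∈ C := by
    intro m
    induction m with
    | zero => rfl
    | succ m ih => exact (hC.forall_zpow_succ_iff h0 hc hd m).trans ih
  refine (hC.subset_Cinf h0 hc hd).antisymm fun x hx => ?_
  obtain ⟨k, p, hxΛ, γ, hγ, hxγ⟩ := Set.mem_iUnion₂.1 hx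
  refine hC.mem_of_mul hxΛ hγ ?_
  rw [← hxγ, ← zpow_natCast]
  exact (iff_zero (k + 1)).2 ((iff_zero ℓ).1 h) p (by positivity)

/-- If `C ≠ C_∞(i)`, then the largest `q` with `α_{ℓ-1}(i) b^q ∈ C` exists and is congruent to
`i_ℓ` modulo `d`. -/
theorem exists_greatest (hC : IsDH c d C) (h0 : C0 c d d i ⊆ C) (hne : C ≠ Cinf c d d i)
    (hc : 0 < c) (hd : 0 < d) (ℓ : ℕ) :
    ∃ n : ℤ, 0 ≤ n ∧ ∀ q : ℤ, 0 ≤ q →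
      (alphaPre c d d i ℓ * bsb c d ^ q ∈ C ↔ q ≤ d * n + i ℓ) := by
  obtain ⟨r, hr, hrC⟩ : ∃ r : ℤ, 0 ≤ r ∧ alphaPre c d d i ℓ * bsb c d ^ r ∉ C := by
    by_contra! h
    exact hne (hC.eq_Cinf h0 hc hd ℓ h)
  obtain ⟨M, ⟨hM0, hMC⟩, hM⟩ := Int.exists_greatest_of_bdd
    (P := fun q : ℤ => 0 ≤ q ∧ alphaPre c d d i ℓ * bsb c d ^ q ∈ C)
    ⟨r, fun q hq => le_of_not_ge fun hrq => hrC (hC.alphaPre_mul_zpow_mono hr hrq hq.2)⟩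
    ⟨0, le_rfl, by simpa using alphaPre_mem_of_C0_subset h0 ℓ⟩
  obtain ⟨n, hn, hMn, hmem⟩ := hC.exists_le h0 hc.ne' hd hM0 hMC
  have hn' := (hC.alphaPre_mul_zpow_iff h0 hc hd hn).1 hmem
  exact ⟨n, hn, fun q hq => ⟨fun h => (hM q ⟨hq, h⟩).trans hMn,
    fun h => hC.alphaPre_mul_zpow_mono hq h hn'⟩⟩

end IsDH

/-- Case (BS1).  If `C` is directed hereditary with `C₀(i) ⊆ C ⊊ C_∞(i)`, then there is a
sequence `n : ℕ → ℤ` of nonnegative integers satisfying, for all `ℓ ≥ 1`,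
`(c·n_{ℓ-1} − i_ℓ)/d ≤ n_ℓ < (c·(n_{ℓ-1}+1) − i_ℓ)/d` (equivalently,
`c·n_{ℓ-1} − i_ℓ ≤ d·n_ℓ < c·(n_{ℓ-1}+1) − i_ℓ`), such that
`C = ⋃_{ℓ≥0} [α_{ℓ-1}(i) b^{n_ℓ·d + i_ℓ}]`. -/
theorem statement17 (c d : ℤ) (hd : 1 ≤ d) (hcd : d ≤ c)
    (i : BSSeq d) (C : Set (BSGroup c d)) (hC : IsDH c d C)
    (h0 : C0 c d d i ⊆ C) (hne : C ≠ Cinf c d d i) :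
    ∃ n : ℕ → ℤ, (∀ ℓ, 0 ≤ n ℓ) ∧
      (∀ ℓ : ℕ, c * n ℓ - (i (ℓ + 1) : ℤ) ≤ d * n (ℓ + 1) ∧
        d * n (ℓ + 1) < c * (n ℓ + 1) - (i (ℓ + 1) : ℤ)) ∧
      C = ⋃ ℓ : ℕ, seg c d (alphaPre c d d i ℓ * bsb c d ^ (n ℓ * d + (i ℓ : ℤ))) := by
  have hd0 : 0 < d := by omega
  have hc0 : 0 < c := by omega
  choose n hn hmax using hC.exists_greatest h0 hne hc0 hd0
  have hmem (ℓ : ℕ) (q : ℤ) (hq : 0 ≤ q) :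
      c * q ≤ d * n (ℓ + 1) + i (ℓ + 1) ↔ q ≤ n ℓ := by
    have hi := (i ℓ).2.1
    rw [← hmax (ℓ + 1) (c * q) (by positivity), hC.alphaPre_mul_zpow_iff h0 hc0 hd0 hq,
      hmax ℓ _ (by positivity), add_le_add_iff_right, mul_le_mul_iff_right₀ hd0]
  refine ⟨n, hn, fun ℓ => ⟨?_, ?_⟩, Set.Subset.antisymm (fun x hx => ?_)
    (Set.iUnion_subset fun ℓ x hx => ?_)⟩
  · have := (hmem ℓ (n ℓ) (hn ℓ)).2 le_rfl
    omega
  · have := (hmem ℓ (n ℓ + 1) (by linarith [hn ℓ])).not.2 (by omega)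
    omega
  · obtain ⟨ℓ, q, hq, rfl⟩ := hC.exists_eq h0 hc0 hd0 hx
    have hle := (hmax ℓ q hq).1 hx
    refine Set.mem_iUnion.2 ⟨ℓ, hC.2.1 _ hx, bsb c d ^ (d * n ℓ + i ℓ - q),
      bsb_zpow_mem c d (by omega), ?_⟩
    rw [mul_assoc, ← zpow_add, add_sub_cancel, mul_comm d]
  · obtain ⟨hxΛ, γ, hγ, hxγ⟩ := hx
    refine hC.mem_of_mul hxΛ hγ ?_
    have hi := (i ℓ).2.1
    have hnℓ := hn ℓ
    rw [← hxγ, hmax ℓ _ (by positivity), mul_comm]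
end

section
/- Let M and N be abelian groups, and let η : M → M, ξ : N → N, and I : M → N be group homomorphisms such that I ∘ η = ξ ∘ I. Let M̃ be the direct limit of the system M →η M →η M →η ⋯, let Ñ be the direct limit of the system N →ξ N →ξ N →ξ ⋯, and let Ĩ : M̃ → Ñ be the homomorphism induced by I. If (i) ker(I) = ⋃_{n≥1} ker(η^n), and (ii) N = ⋃_{n≥0} ξ^{−n}(I(M)), then Ĩ is an isomorphism. -/
/-- In a sequence of homomorphisms with `κ (n + 1) ∘ ξ = κ n`, one can move `k` stages up by
applying `ξ` `k` times. -/
theorem map_add_iterate_of_comp_eq {N L : Type*} [AddCommGroup N] [AddCommGroup L]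
    {ξ : N →+ N} {κ : ℕ → (N →+ L)} (hκ : ∀ n, (κ (n + 1)).comp ξ = κ n) (n k : ℕ) (y : N) :
    κ (n + k) ((⇑ξ)^[k] y) = κ n y := by
  induction k with
  | zero => rfl
  | succ k ih =>
    rw [Function.iterate_succ_apply', ← ih]
    exact DFunLike.congr_fun (hκ (n + k)) _

/-- Let `η : M → M`, `ξ : N → N`, `I : M → N` be homomorphisms of abelian groups with
`I ∘ η = ξ ∘ I`.  Let `M̃` (resp. `Ñ`) be the direct limit of `M →η M →η ⋯` (resp. of
`N →ξ N →ξ ⋯`), presented by structure maps `ι n : M → M̃` (resp. `κ n : N → Ñ`)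
satisfying the defining properties of the colimit of such a sequence: compatibility
(`ι (n+1) ∘ η = ι n`), joint surjectivity, and the kernel condition
(`ι n x = 0` iff `η^k x = 0` for some `k`).  Let `Ĩ : M̃ → Ñ` be the induced map, i.e.
`Ĩ ∘ ι n = κ n ∘ I` for all `n`.  If (i) `ker I = ⋃ₙ ker ηⁿ` and
(ii) `N = ⋃ₙ ξ⁻ⁿ(I(M))`, then `Ĩ` is an isomorphism. -/
theorem statement18 {M N MT NT : Type*} [AddCommGroup M] [AddCommGroup N]
    [AddCommGroup MT] [AddCommGroup NT]
    (η : M →+ M) (ξ : N →+ N) (I : M →+ N)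
    (hcomm : I.comp η = ξ.comp I)
    (ι : ℕ → (M →+ MT)) (κ : ℕ → (N →+ NT))
    (hι : ∀ n, (ι (n + 1)).comp η = ι n)
    (hκ : ∀ n, (κ (n + 1)).comp ξ = κ n)
    (hιsurj : ∀ y : MT, ∃ n x, ι n x = y)
    (hκsurj : ∀ y : NT, ∃ n x, κ n x = y)
    (hιker : ∀ n x, ι n x = 0 ↔ ∃ k, (⇑η)^[k] x = 0)
    (hκker : ∀ n y, κ n y = 0 ↔ ∃ k, (⇑ξ)^[k] y = 0)
    (Itil : MT →+ NT)
    (hItil : ∀ n, Itil.comp (ι n) = (κ n).comp I)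
    (hker : ∀ x, I x = 0 ↔ ∃ k, (⇑η)^[k] x = 0)
    (hsur : ∀ y : N, ∃ n x, (⇑ξ)^[n] y = I x) :
    Function.Bijective Itil := by
  have hI (n : ℕ) (x : M) : Itil (ι n x) = κ n (I x) := DFunLike.congr_fun (hItil n) x
  have hsemi : Function.Semiconj I η ξ := fun x => DFunLike.congr_fun hcomm x
  refine ⟨(injective_iff_map_eq_zero Itil).2 fun y hy => ?_, fun z => ?_⟩
  · obtain ⟨n, x, rfl⟩ := hιsurj y
    rw [hI] at hy
    obtain ⟨k, hk⟩ := (hκker n (I x)).1 hy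
    rw [← (hsemi.iterate_right k).eq] at hk
    obtain ⟨j, hj⟩ := (hker _).1 hk
    exact (hιker n x).2 ⟨j + k, by rwa [Function.iterate_add_apply]⟩
  · obtain ⟨n, y, rfl⟩ := hκsurj z
    obtain ⟨m, x, hx⟩ := hsur y
    exact ⟨ι (n + m) x, by rw [hI, ← hx, map_add_iterate_of_comp_eq hκ]⟩
end

section
/- Let H be a complex Hilbert space, let c, d be positive integers, and let S_a, S_b be bounded operators on H that are isometries (S_a* S_a = 1 and S_b* S_b = 1) satisfying S_b^d S_a S_b^c = S_a and ∑_{i=0}^{d−1} S_b^i S_a S_a^* (S_b^*)^i = 1. Then S_b is a unitary, i.e., S_b S_b^* = 1. -/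
/-- In a ring, let `t'` be a left inverse of `t`. If `t ^ d * s * t ^ c = s` with `0 < d` and
`∑ i < d, t ^ i * s * s' * t' ^ i = 1`, then `t` is invertible with inverse `t'`. -/
theorem mul_eq_one_of_sum_pow_mul_eq_one {R : Type*} [Ring R] {c d : ℕ} (hd : d ≠ 0)
    {s s' t t' : R} (ht : t' * t = 1) (hrel : t ^ d * s * t ^ c = s)
    (hsum : ∑ i ∈ Finset.range d, t ^ i * s * s' * t' ^ i = 1) : t * t' = 1 := by
  have hshift : t * t' = ∑ i ∈ Finset.range d, t ^ (i + 1) * s * s' * t' ^ (i + 1) := by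
    calc t * t' = t * (∑ i ∈ Finset.range d, t ^ i * s * s' * t' ^ i) * t' := by
          rw [hsum, mul_one]
      _ = _ := by
          simp only [Finset.mul_sum, Finset.sum_mul, pow_succ' t, pow_succ t', mul_assoc]
  have hdefect : 1 - t * t' = s * s' - t ^ d * s * s' * t' ^ d := by
    have h := Finset.sum_range_succ' (fun i => t ^ i * s * s' * t' ^ i) d
    rw [Finset.sum_range_succ, hsum, ← hshift] at h
    simp only [pow_zero, one_mul, mul_one] at h
    rw [sub_eq_sub_iff_add_eq_add, h, add_comm]
  have hker_t : (1 - t * t') * t = 0 := by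
    rw [sub_mul, one_mul, mul_assoc, ht, mul_one, sub_self]
  have hker_pow : (1 - t * t') * t ^ d = 0 := by
    obtain ⟨n, rfl⟩ := Nat.exists_eq_succ_of_ne_zero hd
    rw [pow_succ', ← mul_assoc, hker_t, zero_mul]
  have hker_s : (1 - t * t') * s = 0 := by
    rw [← hrel, ← mul_assoc, ← mul_assoc, hker_pow, zero_mul, zero_mul]
  have hidem : (1 - t * t') * (1 - t * t') = 1 - t * t' := by
    rw [mul_sub, mul_one, ← mul_assoc, hker_t, zero_mul, sub_zero]
  have hzero : (1 - t * t') * (s * s' - t ^ d * s * s' * t' ^ d) = 0 := by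
    simp only [mul_sub _ (s * s'), ← mul_assoc, hker_s, hker_pow, zero_mul, sub_zero]
  rw [← hdefect, hidem] at hzero
  exact (sub_eq_zero.mp hzero).symm


open ContinuousLinearMap in
/-- Let `H` be a complex Hilbert space, `c, d` positive integers, and `S_a, S_b` bounded
operators on `H` which are isometries (`S_a* S_a = 1`, `S_b* S_b = 1`) satisfying
`S_b^d S_a S_b^c = S_a` and `∑_{i<d} S_b^i S_a S_a* (S_b*)^i = 1`.  Then `S_b` is a
unitary: `S_b S_b* = 1`. -/
theorem statement19 {H : Type*} [NormedAddCommGroup H] [InnerProductSpace ℂ H]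
    [CompleteSpace H] (c d : ℕ) (hc : 0 < c) (hd : 0 < d)
    (Sa Sb : H →L[ℂ] H)
    (ha : adjoint Sa * Sa = 1) (hb : adjoint Sb * Sb = 1)
    (hrel : Sb ^ d * Sa * Sb ^ c = Sa)
    (hsum : ∑ i ∈ Finset.range d, Sb ^ i * Sa * adjoint Sa * (adjoint Sb) ^ i = 1) :
    Sb * adjoint Sb = 1 := by
  exact mul_eq_one_of_sum_pow_mul_eq_one hd.ne' hb hrel hsum
end
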